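/- Let X be a smooth projective variety over an algebraically closed field, φ: X → X a separable morphism, and L an ample line bundle on X with φ*(L) ≅ L^{⊗d} for some d > 1. If the Kodaira dimension of X is ≥ 0 (i.e. H^0(X, ω_X^{⊗n}) ≠ 0 for some n > 0), then the class of the canonical line bundle ω_X is torsion in Pic(X). -/

import Mathlib

open AlgebraicGeometry CategoryTheory CategoryTheory.Limits Opposite

noncomputable section

universe u

/-- Restriction of sections of the structure sheaf, as a ring homomorphism. -/
def sres (X : Scheme.{u}) {V W : X.Opens} (h : V ≤ W) : Γ(X, W) →+* Γ(X, V) :=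
  (X.presheaf.map (homOfLE h).op : Γ(X, W) ⟶ Γ(X, V)).hom

lemma sres_sres (X : Scheme.{u}) {V W T : X.Opens} (h₁ : V ≤ W) (h₂ : W ≤ T) (a : Γ(X, T)) :
    sres X h₁ (sres X h₂ a) = sres X (h₁.trans h₂) a := by
  have : (homOfLE (h₁.trans h₂)).op = (homOfLE h₂).op ≫ (homOfLE h₁).op := rfl
  simp only [sres, this, Functor.map_comp]
  rfl

/-- A line bundle (invertible sheaf) on a scheme `X`, presented by an open cover and a
Čech `1`-cocycle of transition units. -/
structure LineBundle (X : Scheme.{u}) where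
  ι : Type u
  U : ι → X.Opens
  covers : iSup U = ⊤
  t : ∀ i j, (Γ(X, U i ⊓ U j))ˣ
  cocycle : ∀ i j l,
    Units.map (sres X (show U i ⊓ U j ⊓ U l ≤ U i ⊓ U j from inf_le_left)).toMonoidHom (t i j)
      * Units.map (sres X (show U i ⊓ U j ⊓ U l ≤ U j ⊓ U l from
          le_inf (inf_le_left.trans inf_le_right) inf_le_right)).toMonoidHom (t j l)
    = Units.map (sres X (show U i ⊓ U j ⊓ U l ≤ U i ⊓ U l from
          le_inf (inf_le_left.trans inf_le_left) inf_le_right)).toMonoidHom (t i l)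

namespace LineBundle

variable {X Y : Scheme.{u}}

/-- The `n`-th tensor power of a line bundle. -/
def pow (L : LineBundle X) (n : ℕ) : LineBundle X where
  ι := L.ι
  U := L.U
  covers := L.covers
  t i j := L.t i j ^ n
  cocycle i j l := by
    simp only [map_pow, ← mul_pow, L.cocycle i j l]

/-- The dual (inverse) of a line bundle. -/
def dual (L : LineBundle X) : LineBundle X where
  ι := L.ι
  U := L.U
  covers := L.covers
  t i j := (L.t i j)⁻¹
  cocycle i j l := by
    simp only [map_inv, ← mul_inv, L.cocycle i j l]

/-- The trivial line bundle. -/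
def trivial (X : Scheme.{u}) : LineBundle X where
  ι := PUnit
  U _ := ⊤
  covers := by simp
  t _ _ := 1
  cocycle _ _ _ := by simp

lemma unit_sres_sres (X : Scheme.{u}) {V W T : X.Opens} (h₁ : V ≤ W) (h₂ : W ≤ T)
    (u : (Γ(X, T))ˣ) :
    Units.map (sres X h₁).toMonoidHom (Units.map (sres X h₂).toMonoidHom u)
      = Units.map (sres X (h₁.trans h₂)).toMonoidHom u := by
  ext
  exact sres_sres X h₁ h₂ u

/-- The tensor product of two line bundles. -/
def tensor (L M : LineBundle X) : LineBundle X where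
  ι := L.ι × M.ι
  U p := L.U p.1 ⊓ M.U p.2
  covers := by
    apply le_antisymm le_top
    have h : (⊤ : X.Opens) = (⨆ i, L.U i) ⊓ ⨆ j, M.U j := by
      rw [L.covers, M.covers, top_inf_eq]
    rw [h, iSup_inf_eq]
    refine iSup_le fun i => ?_
    rw [inf_iSup_eq]
    exact iSup_le fun j => le_iSup_of_le (i, j) le_rfl
  t p q :=
    Units.map (sres X (show (L.U p.1 ⊓ M.U p.2) ⊓ (L.U q.1 ⊓ M.U q.2) ≤ L.U p.1 ⊓ L.U q.1 from
        le_inf (inf_le_left.trans inf_le_left) (inf_le_right.trans inf_le_left))).toMonoidHom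
      (L.t p.1 q.1) *
    Units.map (sres X (show (L.U p.1 ⊓ M.U p.2) ⊓ (L.U q.1 ⊓ M.U q.2) ≤ M.U p.2 ⊓ M.U q.2 from
        le_inf (inf_le_left.trans inf_le_right) (inf_le_right.trans inf_le_right))).toMonoidHom
      (M.t p.2 q.2)
  cocycle p q r := by
    simp only [map_mul, unit_sres_sres]
    have hL := congrArg (Units.map (sres X (show
        (L.U p.1 ⊓ M.U p.2) ⊓ (L.U q.1 ⊓ M.U q.2) ⊓ (L.U r.1 ⊓ M.U r.2) ≤
          L.U p.1 ⊓ L.U q.1 ⊓ L.U r.1 from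
        le_inf (le_inf (inf_le_left.trans (inf_le_left.trans inf_le_left))
          (inf_le_left.trans (inf_le_right.trans inf_le_left)))
          (inf_le_right.trans inf_le_left))).toMonoidHom) (L.cocycle p.1 q.1 r.1)
    have hM := congrArg (Units.map (sres X (show
        (L.U p.1 ⊓ M.U p.2) ⊓ (L.U q.1 ⊓ M.U q.2) ⊓ (L.U r.1 ⊓ M.U r.2) ≤
          M.U p.2 ⊓ M.U q.2 ⊓ M.U r.2 from
        le_inf (le_inf (inf_le_left.trans (inf_le_left.trans inf_le_right))
          (inf_le_left.trans (inf_le_right.trans inf_le_right)))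
          (inf_le_right.trans inf_le_right))).toMonoidHom) (M.cocycle p.2 q.2 r.2)
    simp only [map_mul, unit_sres_sres] at hL hM
    rw [mul_mul_mul_comm, hL, hM]

lemma preimage_mono (f : X ⟶ Y) {U U' : Y.Opens} (h : U ≤ U') : f ⁻¹ᵁ U ≤ f ⁻¹ᵁ U' :=
  fun _ hx => h hx

lemma unit_sres_appLE (f : X ⟶ Y) {U : Y.Opens} {V V' : X.Opens} (e : V ≤ f ⁻¹ᵁ U)
    (h : V' ≤ V) (u : (Γ(Y, U))ˣ) :
    Units.map (sres X h).toMonoidHom (Units.map (f.appLE U V e).hom.toMonoidHom u)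
      = Units.map (f.appLE U V' (h.trans e)).hom.toMonoidHom u := by
  ext
  show sres X h (f.appLE U V e u) = f.appLE U V' (h.trans e) u
  rw [show f.appLE U V' (h.trans e)
      = f.appLE U V e ≫ X.presheaf.map (homOfLE h).op from (f.appLE_map e (homOfLE h).op).symm]
  rfl

lemma unit_appLE_sres (f : X ⟶ Y) {U U' : Y.Opens} {V : X.Opens} (e : V ≤ f ⁻¹ᵁ U)
    (h : U ≤ U') (u : (Γ(Y, U'))ˣ) :
    Units.map (f.appLE U V e).hom.toMonoidHom (Units.map (sres Y h).toMonoidHom u)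
      = Units.map (f.appLE U' V (e.trans (preimage_mono f h))).hom.toMonoidHom u := by
  ext
  show f.appLE U V e (sres Y h u) = f.appLE U' V _ u
  rw [show f.appLE U' V (e.trans (preimage_mono f h))
      = Y.presheaf.map (homOfLE h).op ≫ f.appLE U V e from (f.map_appLE e (homOfLE h).op).symm]
  rfl

lemma preimage_inf (f : X ⟶ Y) (U V : Y.Opens) :
    f ⁻¹ᵁ (U ⊓ V) = f ⁻¹ᵁ U ⊓ f ⁻¹ᵁ V := by
  ext x; simp

set_option maxHeartbeats 1000000 in
/-- The pullback of a line bundle along a morphism of schemes. -/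
def pullbackLB (f : X ⟶ Y) (L : LineBundle Y) : LineBundle X where
  ι := L.ι
  U i := f ⁻¹ᵁ L.U i
  covers := by
    have : (⨆ i, f ⁻¹ᵁ L.U i) = f ⁻¹ᵁ (⨆ i, L.U i) := by
      ext x
      simp [TopologicalSpace.Opens.mem_iSup]
    rw [this, L.covers]
    rfl
  t i j :=
    Units.map (f.appLE (L.U i ⊓ L.U j) (f ⁻¹ᵁ L.U i ⊓ f ⁻¹ᵁ L.U j)
      (preimage_inf f (L.U i) (L.U j)).ge).hom.toMonoidHom (L.t i j)
  cocycle i j l := by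
    have key := congrArg (Units.map (f.appLE (L.U i ⊓ L.U j ⊓ L.U l)
        (f ⁻¹ᵁ L.U i ⊓ f ⁻¹ᵁ L.U j ⊓ f ⁻¹ᵁ L.U l)
        (le_of_eq (show f ⁻¹ᵁ L.U i ⊓ f ⁻¹ᵁ L.U j ⊓ f ⁻¹ᵁ L.U l
            = f ⁻¹ᵁ (L.U i ⊓ L.U j ⊓ L.U l) by
          rw [preimage_inf, preimage_inf]))).hom.toMonoidHom)
      (L.cocycle i j l)
    rw [map_mul] at key
    rw [unit_sres_appLE, unit_sres_appLE, unit_sres_appLE]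
    rw [unit_appLE_sres, unit_appLE_sres, unit_appLE_sres] at key
    exact key

/-- A global section of a line bundle: compatible local sections with respect to the
transition cocycle. -/
@[ext]
structure GlobalSec {X : Scheme.{u}} (L : LineBundle X) where
  s : ∀ i, Γ(X, L.U i)
  compat : ∀ i j, sres X (inf_le_left : L.U i ⊓ L.U j ≤ L.U i) (s i)
    = (L.t i j : Γ(X, L.U i ⊓ L.U j)) * sres X inf_le_right (s j)

/-- The open locus where a global section of a line bundle does not vanish. -/
def GlobalSec.locus {X : Scheme.{u}} {L : LineBundle X} (σ : GlobalSec L) : X.Opens :=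
  ⨆ i, X.basicOpen (σ.s i)

/-- A line bundle `L` on a scheme `X` is ample if `X` is quasi-compact and every point has
an affine neighbourhood of the form `X_s` for a global section `s` of some positive tensor
power of `L`. -/
def IsAmple {X : Scheme.{u}} (L : LineBundle X) : Prop :=
  CompactSpace X ∧ ∀ x : X, ∃ (m : ℕ) (_ : 0 < m) (σ : GlobalSec (L.pow m)),
    x ∈ σ.locus ∧ IsAffineOpen σ.locus

/-- Two line bundles are isomorphic iff on a common refinement of their trivialising covers
their transition cocycles differ by a coboundary. -/
def EquivLB {X : Scheme.{u}} (L M : LineBundle X) : Prop :=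
  ∃ (κ : Type u) (V : κ → X.Opens) (_ : iSup V = ⊤) (a : κ → L.ι) (b : κ → M.ι)
    (ha : ∀ c, V c ≤ L.U (a c)) (hb : ∀ c, V c ≤ M.U (b c)) (s : ∀ c, (Γ(X, V c))ˣ),
    ∀ c c' : κ,
      Units.map (sres X (le_inf ((inf_le_left.trans (ha c)))
          (inf_le_right.trans (ha c')) : V c ⊓ V c' ≤ L.U (a c) ⊓ L.U (a c'))).toMonoidHom
          (L.t (a c) (a c'))
        * Units.map (sres X (inf_le_right : V c ⊓ V c' ≤ V c')).toMonoidHom (s c')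
      = Units.map (sres X (inf_le_left : V c ⊓ V c' ≤ V c)).toMonoidHom (s c)
        * Units.map (sres X (le_inf ((inf_le_left.trans (hb c)))
            (inf_le_right.trans (hb c')))).toMonoidHom (M.t (b c) (b c'))

/-- The canonical algebra map `k → Γ(X, U)` for a scheme `X` over `Spec k`. -/
def toSections {k : Type u} [Field k] {X : Scheme.{u}} (sX : X ⟶ Spec (CommRingCat.of k))
    (U : X.Opens) : k →+* Γ(X, U) :=
  ((sres X (le_top : U ≤ ⊤)).comp
    ((sX.appTop.hom : Γ(Spec (CommRingCat.of k), ⊤) →+* Γ(X, ⊤)))).comp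
    ((Scheme.ΓSpecIso (CommRingCat.of k)).inv : CommRingCat.of k ⟶ _).hom

lemma sres_toSections {k : Type u} [Field k] {X : Scheme.{u}}
    (sX : X ⟶ Spec (CommRingCat.of k)) {V U : X.Opens} (h : V ≤ U) (c : k) :
    sres X h (toSections sX U c) = toSections sX V c := by
  simp only [toSections, RingHom.comp_apply, sres_sres]

/-- The space of global sections of a line bundle on a scheme over `k`, as a `k`-submodule
of the product of the local section spaces. -/
def secSubmodule {k : Type u} [Field k] {X : Scheme.{u}} (sX : X ⟶ Spec (CommRingCat.of k))
    (L : LineBundle X) :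
    letI : ∀ i, Module k Γ(X, L.U i) := fun i => (toSections sX (L.U i)).toModule
    Submodule k (∀ i, Γ(X, L.U i)) :=
  letI : ∀ i, Module k Γ(X, L.U i) := fun i => (toSections sX (L.U i)).toModule
  { carrier := {s | ∀ i j, sres X (inf_le_left : L.U i ⊓ L.U j ≤ L.U i) (s i)
      = (L.t i j : Γ(X, L.U i ⊓ L.U j)) * sres X inf_le_right (s j)}
    add_mem' := by
      intro s r hs hr i j
      simp only [Pi.add_apply, map_add, hs i j, hr i j, mul_add]
    zero_mem' := by
      intro i j
      simp
    smul_mem' := by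
      intro c s hs i j
      show sres X _ (toSections sX (L.U i) c * s i)
        = (L.t i j : Γ(X, L.U i ⊓ L.U j)) * sres X _ (toSections sX (L.U j) c * s j)
      rw [map_mul, map_mul, hs i j, sres_toSections, sres_toSections]
      ring }

/-- The dimension `h⁰(X, L)` of the space of global sections of a line bundle on a scheme
over a field `k`. -/
def h0 {k : Type u} [Field k] {X : Scheme.{u}} (sX : X ⟶ Spec (CommRingCat.of k))
    (L : LineBundle X) : ℕ :=
  letI : ∀ i, Module k Γ(X, L.U i) := fun i => (toSections sX (L.U i)).toModule
  Module.finrank k (secSubmodule sX L)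

lemma sres_appLE (f : X ⟶ Y) {U : Y.Opens} {V V' : X.Opens} (e : V ≤ f ⁻¹ᵁ U)
    (h : V' ≤ V) (a : Γ(Y, U)) :
    sres X h (f.appLE U V e a) = f.appLE U V' (h.trans e) a := by
  rw [show f.appLE U V' (h.trans e)
      = f.appLE U V e ≫ X.presheaf.map (homOfLE h).op from (f.appLE_map e (homOfLE h).op).symm]
  rfl

lemma appLE_sres (f : X ⟶ Y) {U U' : Y.Opens} {V : X.Opens} (e : V ≤ f ⁻¹ᵁ U)
    (h : U ≤ U') (a : Γ(Y, U')) :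
    f.appLE U V e (sres Y h a) = f.appLE U' V (e.trans (preimage_mono f h)) a := by
  rw [show f.appLE U' V (e.trans (preimage_mono f h))
      = Y.presheaf.map (homOfLE h).op ≫ f.appLE U V e from (f.map_appLE e (homOfLE h).op).symm]
  rfl

/-- Pullback of global sections of a line bundle. -/
def pullbackSec (f : X ⟶ Y) (L : LineBundle Y) (σ : GlobalSec L) :
    GlobalSec (pullbackLB f L) where
  s i := f.app (L.U i) (σ.s i)
  compat i j := by
    have key := congrArg (f.appLE (L.U i ⊓ L.U j)
      (f ⁻¹ᵁ L.U i ⊓ f ⁻¹ᵁ L.U j) (preimage_inf f (L.U i) (L.U j)).ge) (σ.compat i j)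
    rw [map_mul, appLE_sres, appLE_sres] at key
    exact key

end LineBundle

attribute [local instance] MvPolynomial.gradedAlgebra

/-- Projective `N`-space over `k`, as the `Proj` of the polynomial ring in `N + 1`
variables with its standard grading. -/
def ProjSpace (k : Type u) [Field k] (N : ℕ) : Scheme.{u} :=
  Proj (MvPolynomial.homogeneousSubmodule (Fin (N + 1)) k)

/-- The inclusion of `k` into the degree-zero part of the polynomial ring. -/
def degreeZeroInclusion (k : Type u) [Field k] (N : ℕ) :
    k →+* (MvPolynomial.homogeneousSubmodule (Fin (N + 1)) k 0) where
  toFun c := ⟨MvPolynomial.C c, by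
    simp [MvPolynomial.mem_homogeneousSubmodule, MvPolynomial.isHomogeneous_C]⟩
  map_one' := by ext; simp
  map_mul' x y := by ext; simp
  map_zero' := by ext; simp
  map_add' x y := by ext; simp

/-- The structure morphism of projective space over `k`. -/
def ProjSpace.str (k : Type u) [Field k] (N : ℕ) :
    ProjSpace k N ⟶ Spec (CommRingCat.of k) :=
  Proj.toSpecZero _ ≫ Spec.map (CommRingCat.ofHom (degreeZeroInclusion k N))

/-- A scheme over `k` is a projective variety if it is integral and admits a closed
immersion into some projective space over `k`, compatibly with the structure morphisms. -/
def IsProjectiveVariety {k : Type u} [Field k] {X : Scheme.{u}}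
    (sX : X ⟶ Spec (CommRingCat.of k)) : Prop :=
  IsIntegral X ∧ ∃ (N : ℕ) (ι : X ⟶ ProjSpace k N),
    IsClosedImmersion ι ∧ ι ≫ ProjSpace.str k N = sX
set_option maxHeartbeats 2000000 in
open LineBundle in
/-- `ω` is a canonical line bundle on the `g`-dimensional smooth variety `X` over `k`:
on its trivialising cover the module of Kähler differentials is free of rank `g`, and the
transition cocycle of `ω` is given by the determinants of the base-change matrices of the
corresponding bases of differentials, i.e. `ω ≅ det Ω¹_{X/k}`. -/
def IsCanonicalBundle {k : Type u} [Field k] {X : Scheme.{u}}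
    (sX : X ⟶ Spec (CommRingCat.of k)) (g : ℕ) (ω : LineBundle X) : Prop :=
  letI : ∀ U : X.Opens, Algebra k Γ(X, U) := fun U => (toSections sX U).toAlgebra
  ∃ e : ∀ i : ω.ι, Module.Basis (Fin g) Γ(X, ω.U i) (Ω[Γ(X, ω.U i)⁄k]),
    ∀ i j : ω.ι,
      letI : Algebra Γ(X, ω.U i) Γ(X, ω.U i ⊓ ω.U j) :=
        (sres X (inf_le_left : ω.U i ⊓ ω.U j ≤ ω.U i)).toAlgebra
      letI : Algebra Γ(X, ω.U j) Γ(X, ω.U i ⊓ ω.U j) :=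
        (sres X (inf_le_right : ω.U i ⊓ ω.U j ≤ ω.U j)).toAlgebra
      haveI : IsScalarTower k Γ(X, ω.U i) Γ(X, ω.U i ⊓ ω.U j) :=
        IsScalarTower.of_algebraMap_eq fun c => (sres_toSections sX _ c).symm
      haveI : IsScalarTower k Γ(X, ω.U j) Γ(X, ω.U i ⊓ ω.U j) :=
        IsScalarTower.of_algebraMap_eq fun c => (sres_toSections sX _ c).symm
      haveI : SMulCommClass k Γ(X, ω.U i) Γ(X, ω.U i ⊓ ω.U j) :=
        ⟨fun c a b => by
          simp only [Algebra.smul_def, ← mul_assoc, mul_comm]⟩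
      haveI : SMulCommClass k Γ(X, ω.U j) Γ(X, ω.U i ⊓ ω.U j) :=
        ⟨fun c a b => by
          simp only [Algebra.smul_def, ← mul_assoc, mul_comm]⟩
      ∃ M : Matrix (Fin g) (Fin g) Γ(X, ω.U i ⊓ ω.U j),
        (∀ a : Fin g,
          KaehlerDifferential.map k k Γ(X, ω.U j) Γ(X, ω.U i ⊓ ω.U j) (e j a)
            = ∑ b : Fin g, M a b •
              KaehlerDifferential.map k k Γ(X, ω.U i) Γ(X, ω.U i ⊓ ω.U j) (e i b)) ∧
        (ω.t i j : Γ(X, ω.U i ⊓ ω.U j)) = M.det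

/-- A self-map of an integral scheme is separable if it fixes the generic point and the
induced extension of function fields is separable. -/
def IsSeparableSelfMap {X : Scheme.{u}} [IsIntegral X] (φ : X ⟶ X) : Prop :=
  ∃ h : φ.base (genericPoint X) = genericPoint X,
    letI E : X.functionField ⟶ X.functionField :=
      (X.presheaf.stalkCongr (Inseparable.of_eq h.symm)).hom ≫ φ.stalkMap (genericPoint X)
    letI : Algebra X.functionField X.functionField := (E.hom : _ →+* _).toAlgebra
    Algebra.IsSeparable X.functionField X.functionField

/-- An element of a field lying in every valuation ring that contains the image of `R` is
integral over `R`. -/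
lemma isIntegral_of_forall_mem_valuationSubring {R K : Type*} [CommRing R] [Field K] [Algebra R K]
    {x : K} (hx : ∀ V : ValuationSubring K, (∀ r, algebraMap R K r ∈ V) → x ∈ V) :
    IsIntegral R x := by
  by_contra h
  have : IsIntegrallyClosedIn (integralClosure R K).toSubring K :=
    inferInstanceAs (IsIntegrallyClosedIn (integralClosure R K) K)
  obtain ⟨V, hV, hxV⟩ := Subring.exists_le_valuationSubring_of_isIntegrallyClosedIn
    (R := (integralClosure R K).toSubring) (x := x) h
  exact hxV (hx V fun r => hV (isIntegral_algebraMap (R := R) (A := K) (x := r)))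

/-- The norm of an element lying in all valuation rings above `W` lies in `W`. -/
lemma ValuationSubring.norm_mem {F K : Type*} [Field F] [Field K] [Algebra F K]
    (W : ValuationSubring F) (b : K)
    (hb : ∀ V : ValuationSubring K, W ≤ V.comap (algebraMap F K) → b ∈ V) :
    Algebra.norm F b ∈ W := by
  have h2 : IsIntegral W b :=
    isIntegral_of_forall_mem_valuationSubring fun V hV => hb V fun x hx => hV ⟨x, hx⟩
  obtain ⟨y, hy⟩ := IsIntegrallyClosed.isIntegral_iff.mp
    (Algebra.isIntegral_norm (R := W) (K := F) h2)
  rw [← hy]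
  exact y.2

namespace MvPolynomial

variable {σ k Q : Type*} [Field k] [Field Q] [Algebra (MvPolynomial σ k) Q]
  [IsFractionRing (MvPolynomial σ k) Q]

variable (σ k Q) in
/-- The valuation ring of the fractions of non-positive total degree. -/
def degreeValuationSubring : ValuationSubring Q where
  carrier := {x | ∃ p q : MvPolynomial σ k, q ≠ 0 ∧ p.totalDegree ≤ q.totalDegree ∧
    x * algebraMap _ Q q = algebraMap _ Q p}
  mul_mem' := by
    rintro x y ⟨p, q, hq, h, e⟩ ⟨p', q', hq', h', e'⟩
    refine ⟨p * p', q * q', mul_ne_zero hq hq', ?_, ?_⟩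
    · rw [totalDegree_mul_of_isDomain hq hq']
      exact (totalDegree_mul _ _).trans (add_le_add h h')
    · rw [map_mul, map_mul, ← e, ← e']; ring
  one_mem' := ⟨1, 1, one_ne_zero, le_rfl, by simp⟩
  add_mem' := by
    rintro x y ⟨p, q, hq, h, e⟩ ⟨p', q', hq', h', e'⟩
    refine ⟨p * q' + p' * q, q * q', mul_ne_zero hq hq', ?_, ?_⟩
    · rw [totalDegree_mul_of_isDomain hq hq']
      refine (totalDegree_add _ _).trans (max_le ?_ ?_)
      · exact (totalDegree_mul _ _).trans (add_le_add_left h _)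
      · refine (totalDegree_mul _ _).trans ?_
        rw [add_comm]
        exact add_le_add_right h' _
    · simp only [map_mul, map_add, ← e, ← e']; ring
  zero_mem' := ⟨0, 1, one_ne_zero, by simp, by simp⟩
  neg_mem' := by
    rintro x ⟨p, q, hq, h, e⟩
    exact ⟨-p, q, hq, by rwa [totalDegree_neg], by rw [map_neg, ← e]; ring⟩
  mem_or_inv_mem' := by
    intro x
    obtain ⟨p, q, hq, rfl⟩ := IsFractionRing.div_surjective (A := MvPolynomial σ k) x
    have hq0 := nonZeroDivisors.ne_zero hq
    have hq1 : algebraMap _ Q q ≠ 0 := by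
      simpa using hq0
    rcases eq_or_ne p 0 with rfl | hp
    · left; exact ⟨0, 1, one_ne_zero, by simp, by simp⟩
    have hp1 : algebraMap _ Q p ≠ 0 := by
      simpa using hp
    rcases le_total p.totalDegree q.totalDegree with h | h
    · exact .inl ⟨p, q, hq0, h, by field_simp⟩
    · exact .inr ⟨q, p, hp, h, by field_simp⟩

lemma div_mem_degreeValuationSubring_iff {p q : MvPolynomial σ k} (hp : p ≠ 0) (hq : q ≠ 0) :
    algebraMap _ Q p / algebraMap _ Q q ∈ degreeValuationSubring σ k Q ↔
      p.totalDegree ≤ q.totalDegree := by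
  have hq1 : algebraMap _ Q q ≠ 0 := by simpa using hq
  refine ⟨?_, fun h => ⟨p, q, hq, h, by field_simp⟩⟩
  rintro ⟨p', q', hq', h, e⟩
  have hq1' : algebraMap _ Q q' ≠ 0 := by simpa using hq'
  have e2 : p * q' = p' * q := by
    apply IsFractionRing.injective (MvPolynomial σ k) Q
    rw [map_mul, map_mul, ← e]; field_simp
  have hp' : p' ≠ 0 := by
    rintro rfl
    simp [hp, hq'] at e2
  have := congrArg totalDegree e2
  rw [totalDegree_mul_of_isDomain hp hq', totalDegree_mul_of_isDomain hp' hq] at this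
  omega

/-- Above the degree valuation, any nonzero element of an algebraic extension is bounded by a
power of a variable. -/
lemma exists_div_X_pow_mem {K : Type*} [Field K] [Algebra Q K] [Algebra.IsAlgebraic Q K]
    (i : σ) (ρ : K) : ∃ c : ℕ, ∀ V : ValuationSubring K,
      degreeValuationSubring σ k Q ≤ V.comap (algebraMap Q K) →
      ∀ c' ≥ c, ρ / algebraMap Q K (algebraMap (MvPolynomial σ k) Q (X i)) ^ c' ∈ V := by
  have halg : IsAlgebraic (degreeValuationSubring σ k Q) ρ := by
    have : Algebra.IsAlgebraic (degreeValuationSubring σ k Q) Q :=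
      IsLocalization.isAlgebraic _ (nonZeroDivisors (degreeValuationSubring σ k Q))
    exact (Algebra.IsAlgebraic.isAlgebraic (R := Q) ρ).restrictScalars _
  obtain ⟨⟨y, p, q, hq, hpq, e⟩, hy, h_int⟩ := halg.exists_integral_multiple
  refine ⟨q.totalDegree, fun V hV c' hc' => ?_⟩
  have hq1 : algebraMap _ Q q ≠ 0 := by simpa using hq
  have hX : algebraMap (MvPolynomial σ k) Q (X i) ≠ 0 := by simp
  have hy' : y ≠ 0 := fun h => hy (Subtype.ext h)
  have hp : p ≠ 0 := by
    rintro rfl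
    simp [hy', hq] at e
  have hp1 : algebraMap _ Q p ≠ 0 := by simpa using hp
  have h1 : algebraMap Q K y * ρ ∈ V := by
    have h2 : IsIntegral V (algebraMap Q K y * ρ) := by
      obtain ⟨f, hf, hf0⟩ := h_int
      refine ⟨f.map (((algebraMap Q K).comp (degreeValuationSubring σ k Q).subtype).codRestrict
        V.toSubring fun x => hV x.2), hf.map _, ?_⟩
      rw [Polynomial.eval₂_map]
      rw [← Algebra.smul_def]
      exact hf0
    obtain ⟨z, hz⟩ := IsIntegrallyClosed.isIntegral_iff.mp h2
    rw [← hz]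
    exact z.2
  have h2 : y⁻¹ / algebraMap (MvPolynomial σ k) Q (X i) ^ c' ∈ degreeValuationSubring σ k Q := by
    have : y⁻¹ / algebraMap (MvPolynomial σ k) Q (X i) ^ c' =
        algebraMap _ Q q / algebraMap _ Q (p * X i ^ c') := by
      rw [map_mul, map_pow, ← e]; field_simp
    rw [this, div_mem_degreeValuationSubring_iff hq (mul_ne_zero hp (pow_ne_zero _ (X_ne_zero i))),
      totalDegree_mul_of_isDomain hp (pow_ne_zero _ (X_ne_zero i)), totalDegree_X_pow]
    omega
  have h3 := mul_mem h1 (hV h2)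
  convert h3 using 1
  have : algebraMap Q K y ≠ 0 := by simpa
  simp only [map_div₀, map_inv₀, map_pow]
  field_simp

end MvPolynomial

namespace MvPolynomial

/-- A bound, linear in the allowed pole order `N`, for the vanishing order along `h` of rational
functions on a normal affine variety which is finite over affine space. -/
lemma vanishing_bound_of_finite {σ k A K : Type*} [Field k] [CommRing A] [IsDomain A]
    [IsIntegrallyClosed A] [Field K] [Algebra A K] [IsFractionRing A K]
    [Algebra (MvPolynomial σ k) A] [Module.Finite (MvPolynomial σ k) A]
    [FaithfulSMul (MvPolynomial σ k) A] [Algebra k K] (hk : ∀ c : k,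
      algebraMap A K (algebraMap (MvPolynomial σ k) A (C c)) = algebraMap k K c)
    (h : A) (h0 : h ≠ 0) (hu : ¬ IsUnit h) (ℓ : ValuationSubring K → K)
    (hℓ0 : ∀ V, ℓ V ≠ 0) (hℓ : (Set.range ℓ).Finite) :
    ∃ C : ℕ, ∀ (N a : ℕ) (f : K), f ≠ 0 →
      (∀ V : ValuationSubring K, (∀ c : k, algebraMap k K c ∈ V) → f / ℓ V ^ N ∈ V) →
      (∀ V : ValuationSubring K, (∀ c : A, algebraMap A K c ∈ V) →
        f / algebraMap A K h ^ a ∈ V) → a ≤ C * N := by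
  let Q := FractionRing (MvPolynomial σ k)
  algebraize [(algebraMap A K).comp (algebraMap (MvPolynomial σ k) A)]
  have : FaithfulSMul (MvPolynomial σ k) K := (faithfulSMul_iff_algebraMap_injective _ _).mpr
    ((IsFractionRing.injective A K).comp (FaithfulSMul.algebraMap_injective (MvPolynomial σ k) A))
  let : Algebra Q K := FractionRing.liftAlgebra (MvPolynomial σ k) K
  have : IsScalarTower (MvPolynomial σ k) Q K :=
    FractionRing.isScalarTower_liftAlgebra (MvPolynomial σ k) K
  have : Module.IsTorsionFree (MvPolynomial σ k) A := by
    exact inferInstance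
  have : IsIntegralClosure A (MvPolynomial σ k) K := IsIntegralClosure.of_isIntegrallyClosed _ _ _
  have : FiniteDimensional Q K :=
    .of_isLocalization (MvPolynomial σ k) A (nonZeroDivisors (MvPolynomial σ k))
  have hnorm : ∀ x : A, x ≠ 0 → Algebra.intNorm (MvPolynomial σ k) A x ≠ 0 := by
    intro x hx h
    have := Algebra.algebraMap_intNorm (A := MvPolynomial σ k) (K := Q) (L := K) x
    rw [h, map_zero, eq_comm, Algebra.norm_eq_zero_iff] at this
    exact hx (IsFractionRing.injective A K (by rw [this, map_zero]))
  set H := Algebra.intNorm (MvPolynomial σ k) A h with hH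
  have hHdeg : 1 ≤ H.totalDegree := by
    by_contra hlt
    have h1 : H.totalDegree = 0 := by omega
    rw [totalDegree_eq_zero_iff_eq_C] at h1
    refine hu (isUnit_of_dvd_unit (Algebra.dvd_algebraMap_intNorm_self (MvPolynomial σ k) A h) ?_)
    refine IsUnit.map _ ?_
    rw [← hH, h1]
    refine IsUnit.map _ (isUnit_iff_ne_zero.mpr fun h2 => hnorm h h0 ?_)
    rw [← hH, h1, h2, map_zero]
  obtain ⟨i⟩ : Nonempty σ := by
    by_contra hσ
    rw [not_nonempty_iff] at hσ
    rw [eq_C_of_isEmpty H, totalDegree_C] at hHdeg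
    omega
  choose c hc using fun ρ : K => exists_div_X_pow_mem (σ := σ) (k := k) (Q := Q) i ρ
  obtain ⟨c0, hc0⟩ : ∃ c0, ∀ V, c (ℓ V) ≤ c0 := by
    obtain ⟨c0, hc0⟩ := (hℓ.image c).bddAbove
    exact ⟨c0, fun V => hc0 ⟨_, ⟨V, rfl⟩, rfl⟩⟩
  set δ := Module.finrank Q K
  refine ⟨c0 * δ, fun N a f hf h1 h2 => ?_⟩
  have h_int : IsIntegral A (f / algebraMap A K h ^ a) :=
    isIntegral_of_forall_mem_valuationSubring h2
  obtain ⟨x, hx⟩ := IsIntegrallyClosed.isIntegral_iff.mp h_int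
  have hh : algebraMap A K h ≠ 0 := by simpa
  have hfx : f = algebraMap A K (h ^ a * x) := by
    rw [map_mul, hx, map_pow]; field_simp
  have hx0 : x ≠ 0 := by
    rintro rfl
    simp [hf] at hfx
  set G := Algebra.intNorm (MvPolynomial σ k) A x with hG
  have hX : algebraMap (MvPolynomial σ k) Q (X i) ≠ 0 := by simp
  have hXK : algebraMap Q K (algebraMap (MvPolynomial σ k) Q (X i)) ≠ 0 := by simp
  have hmem := ValuationSubring.norm_mem (degreeValuationSubring σ k Q)
    (f / algebraMap Q K (algebraMap (MvPolynomial σ k) Q (X i)) ^ (c0 * N)) (by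
      intro V hV
      have hkV : ∀ c : k, algebraMap k K c ∈ V := by
        intro c
        rw [← hk]
        have : algebraMap (MvPolynomial σ k) Q (C c) / algebraMap (MvPolynomial σ k) Q 1 ∈
            degreeValuationSubring σ k Q := by
          rw [div_eq_mul_inv, map_one, inv_one, mul_one]
          exact ⟨C c, 1, one_ne_zero, by simp, by simp⟩
        have := hV this
        rwa [ValuationSubring.mem_comap, map_one, div_one, ← IsScalarTower.algebraMap_apply,
          IsScalarTower.algebraMap_apply (MvPolynomial σ k) A K] at this
      have e : f / algebraMap Q K (algebraMap (MvPolynomial σ k) Q (X i)) ^ (c0 * N) =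
          f / ℓ V ^ N *
            (ℓ V / algebraMap Q K (algebraMap (MvPolynomial σ k) Q (X i)) ^ c0) ^ N := by
        have := hℓ0 V
        rw [div_pow, ← pow_mul, div_mul_div_cancel₀ (pow_ne_zero _ this)]
      rw [e]
      exact mul_mem (h1 V hkV) (pow_mem (hc _ V hV _ (hc0 V)) _))
  have hval :
      Algebra.norm Q (f / algebraMap Q K (algebraMap (MvPolynomial σ k) Q (X i)) ^ (c0 * N)) =
      algebraMap (MvPolynomial σ k) Q (H ^ a * G) /
        algebraMap (MvPolynomial σ k) Q (X i ^ (c0 * N * δ)) := by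
    have hY := pow_ne_zero (c0 * N) hXK
    have hdiv : ∀ z w : K, w ≠ 0 →
        Algebra.norm Q (z / w) = Algebra.norm Q z / Algebra.norm Q w := fun z w hw =>
      eq_div_of_mul_eq (Algebra.norm_ne_zero_iff.mpr hw) (by rw [← map_mul, div_mul_cancel₀ _ hw])
    rw [hdiv _ _ hY, map_pow, Algebra.norm_algebraMap, hfx,
      ← Algebra.algebraMap_intNorm (A := MvPolynomial σ k) (K := Q) (L := K), map_mul, map_pow,
      map_pow, ← pow_mul,
      mul_comm δ]
  have hG0 := hnorm x hx0
  have hH0 := hnorm h h0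
  rw [hval, div_mem_degreeValuationSubring_iff (mul_ne_zero (pow_ne_zero _ hH0) hG0)
    (pow_ne_zero _ (X_ne_zero i)), totalDegree_mul_of_isDomain (pow_ne_zero _ hH0) hG0,
    totalDegree_X_pow] at hmem
  have hpow : ∀ a : ℕ, (H ^ a).totalDegree = a * H.totalDegree := by
    intro a
    induction a with
    | zero => simp
    | succ a ih => rw [pow_succ, totalDegree_mul_of_isDomain (pow_ne_zero _ hH0) hH0, ih]; ring
  rw [hpow] at hmem
  nlinarith

end MvPolynomial

/-- A bound, linear in the allowed pole order `N`, for the vanishing order along `h` of rational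
functions on a normal affine variety. -/
lemma exists_vanishing_bound {k A K : Type*} [Field k] [CommRing A] [IsDomain A]
    [IsIntegrallyClosed A] [Field K] [Algebra A K] [IsFractionRing A K] [Algebra k A]
    [Algebra.FiniteType k A] [Algebra k K] [IsScalarTower k A K]
    (h : A) (h0 : h ≠ 0) (hu : ¬ IsUnit h) (ℓ : ValuationSubring K → K)
    (hℓ0 : ∀ V, ℓ V ≠ 0) (hℓ : (Set.range ℓ).Finite) :
    ∃ C : ℕ, ∀ (N a : ℕ) (f : K), f ≠ 0 →
      (∀ V : ValuationSubring K, (∀ c : k, algebraMap k K c ∈ V) → f / ℓ V ^ N ∈ V) →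
      (∀ V : ValuationSubring K, (∀ c : A, algebraMap A K c ∈ V) →
        f / algebraMap A K h ^ a ∈ V) → a ≤ C * N := by
  obtain ⟨s, g, hg, hfin⟩ := exists_finite_inj_algHom_of_fg k A
  algebraize [g.toRingHom]
  have : Module.Finite (MvPolynomial (Fin s) k) A := hfin
  have : FaithfulSMul (MvPolynomial (Fin s) k) A :=
    (faithfulSMul_iff_algebraMap_injective _ _).mpr hg
  refine MvPolynomial.vanishing_bound_of_finite (σ := Fin s) (k := k) (fun c => ?_) h h0 hu ℓ hℓ0 hℓ
  rw [IsScalarTower.algebraMap_apply k A K]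
  congr 1
  exact g.commutes c

open scoped KaehlerDifferential in
lemma KaehlerDifferential.D_aeval_mvPolynomial {k K ι : Type*} [CommRing k] [CommRing K]
    [Algebra k K] [Fintype ι] (x : ι → K) (F : MvPolynomial ι k) :
    KaehlerDifferential.D k K (MvPolynomial.aeval x F) =
      ∑ i, MvPolynomial.aeval x (MvPolynomial.pderiv i F) • KaehlerDifferential.D k K (x i) := by
  classical
  induction F using MvPolynomial.induction_on with
  | C a => simp
  | add p q hp hq => simp only [map_add, hp, hq, add_smul, Finset.sum_add_distrib]
  | mul_X p j hp =>
    simp only [map_mul, Derivation.leibniz, hp, MvPolynomial.aeval_X, map_add, add_smul,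
      Finset.sum_add_distrib, smul_eq_mul, MvPolynomial.pderiv_X, mul_smul, Finset.smul_sum]
    congr 1
    rw [Finset.sum_eq_single j]
    · simp
    · intro b _ hb
      simp [hb.symm]
    · simp

/-- Over a perfect field, elements with linearly independent differentials are algebraically
independent. -/
lemma algebraicIndependent_of_linearIndependent_D {k K ι : Type*} [Field k] [PerfectField k]
    [Field K] [Algebra k K] [Fintype ι] (x : ι → K)
    (hx : LinearIndependent K fun i => KaehlerDifferential.D k K (x i)) :
    AlgebraicIndependent k x := by
  rw [algebraicIndependent_iff]
  by_contra! hne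
  let S := {F : MvPolynomial ι k | MvPolynomial.aeval x F = 0 ∧ F ≠ 0}
  have hS : S.Nonempty := hne
  obtain ⟨hF0, hF⟩ := MvPolynomial.totalDegree.argminOn_mem S hS
  set F := MvPolynomial.totalDegree.argminOn S hS with hFdef
  have hmin : ∀ G : MvPolynomial ι k, G ≠ 0 → MvPolynomial.aeval x G = 0 →
      F.totalDegree ≤ G.totalDegree :=
    fun G h1 h2 => MvPolynomial.totalDegree.argminOn_le S ⟨h2, h1⟩
  have hC : ∀ c, F ≠ MvPolynomial.C c := by
    rintro c hc
    rw [hc, MvPolynomial.aeval_C, map_eq_zero] at hF0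
    rw [hc, hF0, map_zero] at hF
    exact hF rfl
  have hd : ∀ i, MvPolynomial.aeval x (MvPolynomial.pderiv i F) = 0 := by
    have := KaehlerDifferential.D_aeval_mvPolynomial x F
    rw [hF0, map_zero, eq_comm] at this
    exact fun i => (Fintype.linearIndependent_iff.mp hx) _ this i
  have hdeg : ∀ i, MvPolynomial.pderiv i F ≠ 0 →
      (MvPolynomial.pderiv i F).totalDegree < F.totalDegree := by
    intro i hi
    have hlt : ∀ m ∈ (MvPolynomial.pderiv i F).support, (m.sum fun _ e => e) < F.totalDegree := by
      intro m hm
      rw [MvPolynomial.mem_support_iff, MvPolynomial.coeff_pderiv] at hm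
      have := MvPolynomial.le_totalDegree
        (MvPolynomial.mem_support_iff.mpr (left_ne_zero_of_mul hm))
      rw [Finsupp.sum_add_index' (fun _ => rfl) (fun _ _ _ => rfl),
        Finsupp.sum_single_index rfl] at this
      omega
    obtain ⟨m, hm⟩ := MvPolynomial.support_nonempty.mpr hi
    exact (Finset.sup_lt_iff ((Nat.zero_le _).trans_lt (hlt m hm))).mpr hlt
  have hp : ∀ i, MvPolynomial.pderiv i F = 0 := by
    intro i
    by_contra h
    exact absurd (hmin _ h (hd i)) (not_le.mpr (hdeg i h))
  have hcoeff : ∀ m ∈ F.support, ∀ i, (m i : k) = 0 := by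
    intro m hm i
    rcases Nat.eq_zero_or_pos (m i) with h | h
    · simp [h]
    have := congrArg (MvPolynomial.coeff (m - Finsupp.single i 1)) (hp i)
    have hle : Finsupp.single i 1 ≤ m := by
      rw [Finsupp.single_le_iff]; exact h
    rw [MvPolynomial.coeff_pderiv, tsub_add_cancel_of_le hle, MvPolynomial.coeff_zero,
      mul_eq_zero] at this
    rcases this with h1 | h1
    · exact absurd h1 (MvPolynomial.mem_support_iff.mp hm)
    · rw [← h1]
      have : (((m - Finsupp.single i 1 : ι →₀ ℕ) i) + 1 : ℕ) = m i := by simp; omega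
      rw [← this, Nat.cast_add, Nat.cast_one]
  obtain ⟨p, hexp⟩ := ExpChar.exists k
  rcases hexp with _ | hprime
  · have : F.totalDegree = 0 := by
      rw [MvPolynomial.totalDegree_eq_zero_iff]
      intro m hm i
      exact_mod_cast hcoeff m hm i
    exact hC _ (MvPolynomial.totalDegree_eq_zero_iff_eq_C.mp this)
  · have : ExpChar k p := .prime hprime
    have : ExpChar K p := expChar_of_injective_algebraMap (algebraMap k K).injective p
    obtain ⟨i, m, hm, hdvd⟩ := MvPolynomial.exists_mem_support_not_dvd_of_forall_totalDegree_le
      (k := k) (K := K) p hprime (fun s hs => by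
        rw [LinearIndepOn, Fintype.linearIndependent_iff] at hs ⊢
        intro c hc i
        choose b hb using fun i => surjective_frobenius k p (c i)
        have h1 : (∑ i : s, b i • (i : K)) ^ p = 0 := by
          rw [← frobenius_def, map_sum, ← hc]
          refine Finset.sum_congr rfl fun j _ => ?_
          rw [← hb j, frobenius_def, frobenius_def, smul_pow]
        have := hs b (pow_eq_zero_iff hprime.ne_zero |>.mp h1) i
        rw [← hb i, this, map_zero]) hmin hF hF0
    exact hdvd ((CharP.cast_eq_zero_iff k p _).mp (hcoeff m hm i))

open KaehlerDifferential

/-- A `k`-algebra with a basis of `g` differentials which is integrally closed in a field of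
transcendence degree at most `g` has that field as its fraction field. -/
lemma isFractionRing_of_basis_kaehler {k A K : Type u} [Field k] [PerfectField k] [CommRing A]
    [IsDomain A] [Algebra k A] [Field K] [Algebra k K] [Algebra A K] [IsScalarTower k A K]
    [FaithfulSMul A K] [IsIntegrallyClosedIn A K] {g : ℕ} (htr : Algebra.trdeg k K ≤ g)
    (e : Module.Basis (Fin g) A Ω[A⁄k]) : IsFractionRing A K := by
  let F := FractionRing A
  let : Algebra F K := FractionRing.liftAlgebra A K
  have : IsScalarTower A F K := FractionRing.isScalarTower_liftAlgebra A K
  have : IsScalarTower k F K := IsScalarTower.of_algebraMap_eq fun c => by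
    rw [IsScalarTower.algebraMap_apply k A F, ← IsScalarTower.algebraMap_apply A F K,
      ← IsScalarTower.algebraMap_apply k A K]
  let eF := e.ofIsLocalizedModule F (nonZeroDivisors A) (KaehlerDifferential.map k k A F)
  have hspan : Submodule.span F (Set.range fun a : A => D k F (algebraMap A F a)) = ⊤ :=
    by
    have h := KaehlerDifferential.span_range_map_derivation_of_isLocalization k A F
      (nonZeroDivisors A)
    rwa [show ⇑(KaehlerDifferential.map k k A F) ∘ ⇑(D k A) =
      fun a : A => D k F (algebraMap A F a) from funext fun a => by simp] at h
  obtain ⟨b, hb, hbspan, hbli⟩ := exists_linearIndependent F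
    (Set.range fun a : A => D k F (algebraMap A F a))
  rw [hspan] at hbspan
  let B : Module.Basis b F Ω[F⁄k] := Module.Basis.mk hbli (by simp [hbspan])
  let eq : b ≃ Fin g := B.indexEquiv eF
  have : Fintype b := Fintype.ofEquiv _ eq.symm
  choose x hx using fun i : b => hb i.2
  have hind := algebraicIndependent_of_linearIndependent_D (k := k)
    (fun i => algebraMap A F (x i)) (by
      have : (fun i => D k F (algebraMap A F (x i))) = ((↑) : b → Ω[F⁄k]) := funext hx
      rw [this]
      exact hbli)
  have h1 := hind.cardinalMk_le_trdeg
  have h2 : Cardinal.mk b = g := by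
    rw [Cardinal.mk_fintype, Fintype.card_congr eq, Fintype.card_fin]
  have h3 := trdeg_add_eq (R := k) (S := F) (A := K)
  have h4 : Algebra.trdeg F K = 0 := by
    rw [h2] at h1
    rw [← h3] at htr
    have hg := h1.antisymm (le_self_add.trans htr)
    rw [← hg] at htr
    obtain ⟨m, hm⟩ := Cardinal.lt_aleph0.mp
      ((le_add_self.trans htr).trans_lt Cardinal.natCast_lt_aleph0)
    rw [hm] at htr ⊢
    norm_cast at htr ⊢
    omega
  have : Algebra.IsAlgebraic F K := trdeg_eq_zero_iff.mp h4
  have : Algebra.IsAlgebraic A F := by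
    exact (IsFractionRing.comap_isAlgebraic_iff (K := F)).mpr inferInstance
  have : Algebra.IsAlgebraic A K := Algebra.IsAlgebraic.trans A F K
  refine IsFractionRing.of_field A K fun z => ?_
  obtain ⟨y, hy, h_int⟩ := (Algebra.IsAlgebraic.isAlgebraic (R := A) z).exists_integral_multiple
  obtain ⟨w, hw⟩ := (IsIntegrallyClosedIn.isIntegral_iff).mp h_int
  have hy0 : algebraMap A K y ≠ 0 := by simpa
  exact ⟨w, y, by rw [hw, Algebra.smul_def]; field_simp⟩

/-- A basis of the differentials of a domain induces one for its fraction field. -/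
noncomputable def kaehlerBasisOfIsFractionRing {k A K : Type*} [Field k] [CommRing A] [Algebra k A]
    [Field K] [Algebra k K] [Algebra A K] [IsScalarTower k A K]
    [IsFractionRing A K] {ι : Type*} (e : Module.Basis ι A Ω[A⁄k]) : Module.Basis ι K Ω[K⁄k] :=
  e.ofIsLocalizedModule K (nonZeroDivisors A) (KaehlerDifferential.map k k A K)

lemma kaehlerBasisOfIsFractionRing_apply {k A K : Type*} [Field k] [CommRing A] [Algebra k A]
    [Field K] [Algebra k K] [Algebra A K] [IsScalarTower k A K]
    [IsFractionRing A K] {ι : Type*} (e : Module.Basis ι A Ω[A⁄k]) (i : ι) :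
    kaehlerBasisOfIsFractionRing (K := K) e i = KaehlerDifferential.map k k A K (e i) :=
  Module.Basis.ofIsLocalizedModule_apply _ _ _ _ _

/-- A basis of differentials stays a basis under a separable algebraic field extension. -/
lemma exists_kaehlerBasis_of_isSeparable {k F K ι : Type*} [Field k] [Field F] [Field K]
    [Algebra k F]
    [Algebra k K] [Algebra F K] [IsScalarTower k F K] [Algebra.IsSeparable F K]
    (e : Module.Basis ι F Ω[F⁄k]) :
    ∃ e' : Module.Basis ι K Ω[K⁄k], ∀ i, e' i = KaehlerDifferential.map k k F K (e i) := by
  have : Algebra.FormallyEtale F K := Algebra.FormallyEtale.of_isSeparable F K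
  have h := KaehlerDifferential.isBaseChange_of_formallyEtale k F K
  exact ⟨h.basis e, fun i => h.basis_apply e i⟩

/-- The Krull dimension does not drop along an injective integral extension. -/
lemma ringKrullDim_le_of_isIntegral (R S : Type*) [CommRing R] [CommRing S] [Algebra R S]
    [Algebra.IsIntegral R S] [FaithfulSMul R S] : ringKrullDim R ≤ ringKrullDim S := by
  refine iSup_le fun l => ?_
  obtain ⟨⟨Q, _, hQ⟩⟩ := (RelSeries.head l).asIdeal.nonempty_primesOver (S := S)
  obtain ⟨M, hM, -⟩ := Ideal.exists_ltSeries_of_hasGoingUp l Q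
  rw [← hM]
  exact le_iSup_of_le M le_rfl

/-- The transcendence degree of a finitely generated domain is at most its Krull dimension. -/
lemma trdeg_le_of_ringKrullDim_le {k A : Type u} [Field k] [CommRing A] [IsDomain A] [Algebra k A]
    [Algebra.FiniteType k A] {n : ℕ} (h : ringKrullDim A ≤ n) : Algebra.trdeg k A ≤ n := by
  obtain ⟨s, f, hf, hfin⟩ := exists_finite_inj_algHom_of_fg k A
  algebraize [f.toRingHom]
  have : Module.Finite (MvPolynomial (Fin s) k) A := hfin
  have : FaithfulSMul (MvPolynomial (Fin s) k) A :=
    (faithfulSMul_iff_algebraMap_injective _ _).mpr hf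
  have : IsScalarTower k (MvPolynomial (Fin s) k) A := IsScalarTower.of_algHom f
  have h1 := (ringKrullDim_le_of_isIntegral (MvPolynomial (Fin s) k) A).trans h
  rw [MvPolynomial.ringKrullDim_of_isNoetherianRing, ringKrullDim_eq_zero_of_field, zero_add,
    Nat.card_fin] at h1
  rw [← trdeg_add_eq k (MvPolynomial (Fin s) k),
    trdeg_eq_zero_iff (R := MvPolynomial (Fin s) k).mpr inferInstance, add_zero,
    MvPolynomial.trdeg_of_isDomain]
  simpa using h1

open TensorProduct in
/-- A domain étale over a normal domain is normal. -/
lemma isIntegrallyClosed_of_etale (R S : Type*) [CommRing R] [IsDomain R] [IsIntegrallyClosed R]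
    [CommRing S] [IsDomain S] [Algebra R S] [Algebra.Etale R S] : IsIntegrallyClosed S := by
  let F := FractionRing R
  let T := S ⊗[R] F
  have hinj : Function.Injective (algebraMap R S) := by
    exact FaithfulSMul.algebraMap_injective R S
  have : IsLocalization (Algebra.algebraMapSubmonoid S (nonZeroDivisors R)) T := inferInstance
  have hle : Algebra.algebraMapSubmonoid S (nonZeroDivisors R) ≤ nonZeroDivisors S := by
    rintro _ ⟨r, hr, rfl⟩
    simpa [mem_nonZeroDivisors_iff_ne_zero, hinj] using hr
  have : IsDomain T := IsLocalization.isDomain_of_le_nonZeroDivisors T hle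
  let c := Algebra.TensorProduct.comm R F S
  have : IsDomain (F ⊗[R] S) := c.toMulEquiv.isDomain _
  have : Module.Finite F (F ⊗[R] S) := Algebra.FormallyUnramified.finite_of_free F _
  have hT : IsField T := c.symm.toMulEquiv.isField
    (isField_of_isIntegral_of_isField' (Field.toIsField F))
  let : Field T := hT.toField
  have : IsFractionRing S T := by
    have : FaithfulSMul S T := (faithfulSMul_iff_algebraMap_injective _ _).mpr
      (IsLocalization.injective T hle)
    refine IsFractionRing.of_field S T fun z => ?_
    obtain ⟨x, y, rfl⟩ :=
      IsLocalization.exists_mk'_eq (Algebra.algebraMapSubmonoid S (nonZeroDivisors R)) z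
    refine ⟨x, y, ?_⟩
    rw [eq_div_iff, IsLocalization.mk'_spec]
    exact (IsLocalization.map_units T y).ne_zero
  rw [isIntegrallyClosed_iff T]
  intro x hx
  obtain ⟨z, hz⟩ := (TensorProduct.toIntegralClosure_bijective_of_smooth (R := R) (S := S)
    (B := F)).2 ⟨x, hx⟩
  replace hz := congrArg Subtype.val hz
  have key : ∀ z : S ⊗[R] (integralClosure R F), ∃ y : S, algebraMap S T y =
      (TensorProduct.toIntegralClosure R S F z).1 := by
    intro z
    induction z with
    | zero => exact ⟨0, by simp⟩
    | add a b ha hb =>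
      obtain ⟨a', ha⟩ := ha
      obtain ⟨b', hb⟩ := hb
      exact ⟨a' + b', by simp [ha, hb]⟩
    | tmul s c =>
      obtain ⟨c', hc⟩ := (IsIntegrallyClosed.isIntegral_iff (K := F)).mp c.2
      refine ⟨c' • s, ?_⟩
      rw [show (TensorProduct.toIntegralClosure R S F (s ⊗ₜ c)).1 = s ⊗ₜ[R] c.1 from rfl, ← hc,
        Algebra.TensorProduct.algebraMap_apply, Algebra.algebraMap_eq_smul_one (A := F),
        ← TensorProduct.smul_tmul]
      rfl
  obtain ⟨y, hy⟩ := key z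
  exact ⟨y, hy.trans hz⟩

/-- A domain smooth over a field is normal. -/
lemma isIntegrallyClosed_of_smooth (k A : Type*) [Field k] [CommRing A] [IsDomain A]
    [Algebra k A] [Algebra.Smooth k A] : IsIntegrallyClosed A := by
  have h (m : PrimeSpectrum A) : ∃ f ∉ m.asIdeal, IsIntegrallyClosed (Localization.Away f) := by
    obtain ⟨f, hfm, n, _, _, _⟩ :=
      Algebra.IsSmoothAt.exists_isStandardEtale_mvPolynomial (R := k) (p := m.asIdeal)
    have hf : f ≠ 0 := fun h => hfm (h ▸ zero_mem _)
    have : IsDomain (Localization.Away f) := IsLocalization.isDomain_localization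
      (powers_le_nonZeroDivisors_of_noZeroDivisors hf)
    exact ⟨f, hfm, isIntegrallyClosed_of_etale (MvPolynomial (Fin n) k) _⟩
  choose f hfm hf using h
  have hle (m : PrimeSpectrum A) : Submonoid.powers (f m) ≤ nonZeroDivisors A :=
    powers_le_nonZeroDivisors_of_noZeroDivisors fun h => hfm m (h ▸ zero_mem _)
  refine IsIntegrallyClosed.of_localization_submonoid _ hle hf ?_
  rw [eq_bot_iff]
  intro x hx
  rw [Algebra.mem_iInf] at hx
  let I : Ideal A :=
    (LinearMap.range (Algebra.linearMap A (FractionRing A))).comap (LinearMap.toSpanSingleton A _ x)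
  have hI : I = ⊤ := by
    by_contra hI
    obtain ⟨m, hm, hIm⟩ := Ideal.exists_le_maximal I hI
    obtain ⟨a, s, ⟨n, rfl⟩, rfl⟩ := hx ⟨m, hm.isPrime⟩
    have h0 := (IsFractionRing.injective A (FractionRing A)).ne
      (nonZeroDivisors.ne_zero (hle ⟨m, hm.isPrime⟩ (Submonoid.mem_powers _)))
    rw [map_zero] at h0
    exact hfm ⟨m, hm.isPrime⟩ (hm.isPrime.mem_of_pow_mem n (hIm ⟨a, by
      simp [Algebra.smul_def]
      field_simp⟩))
  have h1 : (1 : A) ∈ I := hI ▸ Submodule.mem_top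
  obtain ⟨y, hy⟩ := h1
  rw [Algebra.mem_bot]
  exact ⟨y, by simpa using hy⟩

/-- The pairs `(N, a)` for which the poles of the `a`-th powers of the elements of `D V` and of
`ℓ V ^ (-N)` are bounded, uniformly over the valuation rings `V` of `K` containing `k`, by a
single element of `K`. -/
def HasPoleBound (k : Type*) {K : Type*} [Field k] [Field K] [Algebra k K]
    (D : ValuationSubring K → Set K) (ℓ : ValuationSubring K → K) (N a : ℕ) : Prop :=
  ∃ f : K, f ≠ 0 ∧ ∀ V : ValuationSubring K, (∀ c : k, algebraMap k K c ∈ V) →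
    ∀ κ ∈ D V, f * κ ^ a / ℓ V ^ N ∈ V

/-- Transfer of pole bounds along a finite extension by taking norms. -/
lemma HasPoleBound.norm {k F K : Type*} [Field k] [Field F] [Field K] [Algebra k F] [Algebra k K]
    [Algebra F K] [IsScalarTower k F K] [FiniteDimensional F K]
    {D : ValuationSubring K → Set K} {ℓ : ValuationSubring K → K}
    {D' : ValuationSubring F → Set F} {ℓ' : ValuationSubring F → F}
    (hD' : ∀ W W', (∀ c : k, algebraMap k F c ∈ W) → W ≤ W' → D' W ⊆ D' W')
    (hℓ' : ∀ W W', (∀ c : k, algebraMap k F c ∈ W) → W ≤ W' → ℓ' W' / ℓ' W ∈ W')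
    (hℓ0 : ∀ W, ℓ' W ≠ 0) {J : K} (hJ : J ≠ 0)
    (hJD : ∀ V : ValuationSubring K, (∀ c : k, algebraMap k K c ∈ V) →
      ∀ κ ∈ D' (V.comap (algebraMap F K)), algebraMap F K κ * J ∈ D V)
    {u : K} (hu : u ≠ 0) {d : ℕ}
    (huℓ : ∀ V : ValuationSubring K, (∀ c : k, algebraMap k K c ∈ V) →
      u * ℓ V ^ d / algebraMap F K (ℓ' (V.comap (algebraMap F K))) ∈ V)
    (hℓ0' : ∀ V, ℓ V ≠ 0)
    {N a : ℕ} (h : HasPoleBound k D ℓ N a) :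
    HasPoleBound k D' ℓ' (Module.finrank F K * N) (Module.finrank F K * (d * a)) := by
  obtain ⟨f, hf, H⟩ := h
  set b := f ^ d * J ^ (a * d) * u ^ N with hb
  refine ⟨Algebra.norm F b, Algebra.norm_ne_zero_iff.mpr (by positivity), fun W hW κ hκ => ?_⟩
  have key : Algebra.norm F (b * algebraMap F K (κ ^ (d * a) / ℓ' W ^ N)) ∈ W := by
    refine ValuationSubring.norm_mem W _ fun V hV => ?_
    have hV' (c : k) : algebraMap k K c ∈ V := by
      rw [IsScalarTower.algebraMap_apply k F K]
      exact hV (hW c)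
    set W' := V.comap (algebraMap F K) with hW'
    have h1 := pow_mem (H V hV' _ (hJD V hV' κ (hD' W W' hW hV hκ))) d
    have h2 := pow_mem (huℓ V hV') N
    have h3 : algebraMap F K (ℓ' W' / ℓ' W) ∈ V := hℓ' W W' hW hV
    have h4 := mul_mem (mul_mem h1 h2) (pow_mem h3 N)
    convert h4 using 1
    have e1 := (map_ne_zero (algebraMap F K)).mpr (hℓ0 W)
    have e2 := (map_ne_zero (algebraMap F K)).mpr (hℓ0 W')
    have e3 := hℓ0' V
    rw [hb]
    simp only [map_div₀, map_pow]
    rw [← hW']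
    simp only [div_pow, mul_pow]
    field_simp
    ring
  rw [map_mul, Algebra.norm_algebraMap] at key
  convert key using 1
  rw [div_pow, ← pow_mul, ← pow_mul, mul_comm N, mul_comm (d * a), mul_div_assoc]

/-- The determinants, with respect to `ε`, of families of differentials which are combinations of
differentials of elements of `B` with coefficients in the valuation ring `V`. -/
def kaehlerDets (k : Type*) {K ι : Type*} [Field k] [Field K] [Algebra k K] [Fintype ι]
    [DecidableEq ι] (ε : Module.Basis ι K Ω[K⁄k]) (V : ValuationSubring K) (B : Set K) : Set K :=
  {κ | ∃ η : ι → Ω[K⁄k],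
    (∀ i, η i ∈ Submodule.span V.toSubring (KaehlerDifferential.D k K '' B)) ∧ ε.det η = κ}

section kaehlerDets

variable {k F K ι : Type*} [Field k] [Field F] [Field K] [Algebra k F] [Algebra k K]
  [Fintype ι] [DecidableEq ι]

lemma span_valuationSubring_mono {M : Type*} [AddCommGroup M] [Module K M]
    {V V' : ValuationSubring K} (hV : V ≤ V') {B B' : Set M} (hB : B ⊆ B') {x : M}
    (hx : x ∈ Submodule.span V.toSubring B) : x ∈ Submodule.span V'.toSubring B' := by
  induction hx using Submodule.span_induction with
  | mem x hx => exact Submodule.subset_span (hB hx)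
  | zero => exact zero_mem _
  | add x y _ _ hx hy => exact add_mem hx hy
  | smul a x _ hx => exact Submodule.smul_mem _ (⟨a, hV a.2⟩ : V'.toSubring) hx

lemma kaehlerDets_mono (ε : Module.Basis ι K Ω[K⁄k]) {V V' : ValuationSubring K} (hV : V ≤ V')
    {B B' : Set K} (hB : B ⊆ B') : kaehlerDets k ε V B ⊆ kaehlerDets k ε V' B' := by
  rintro _ ⟨η, hη, rfl⟩
  exact ⟨η, fun i => span_valuationSubring_mono hV (Set.image_mono hB) (hη i), rfl⟩

lemma pow_mul_mem_of_mem_kaehlerDets (ε : Module.Basis ι K Ω[K⁄k]) {V : ValuationSubring K}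
    {B : Set K} {w : K} (hw : ∀ b ∈ B, ∀ i, w * ε.repr (KaehlerDifferential.D k K b) i ∈ V)
    {κ : K} (hκ : κ ∈ kaehlerDets k ε V B) : w ^ Fintype.card ι * κ ∈ V := by
  obtain ⟨η, hη, rfl⟩ := hκ
  have key : ∀ x ∈ Submodule.span V.toSubring (KaehlerDifferential.D k K '' B),
      ∀ i, w * ε.repr x i ∈ V := by
    intro x hx
    induction hx using Submodule.span_induction with
    | mem x hx => obtain ⟨b, hb, rfl⟩ := hx; exact hw b hb
    | zero => simp [zero_mem]
    | add x y _ _ hx hy => intro i; simpa [mul_add] using add_mem (hx i) (hy i)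
    | smul a x _ hx =>
      intro i
      have h : a • x = (a : K) • x := rfl
      rw [h, map_smul, Finsupp.smul_apply, smul_eq_mul, mul_left_comm]
      exact mul_mem a.2 (hx i)
  rw [Module.Basis.det_apply, ← Matrix.det_smul, Matrix.det_apply]
  refine sum_mem fun σ _ => ?_
  rw [Units.smul_def]
  refine zsmul_mem (prod_mem fun i _ => ?_) _
  exact key _ (hη i) _

lemma algebraMap_mul_mem_kaehlerDets [Algebra F K] [IsScalarTower k F K]
    (ε : Module.Basis ι F Ω[F⁄k]) (ε' e' : Module.Basis ι K Ω[K⁄k])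
    (he' : ∀ i, e' i = KaehlerDifferential.map k k F K (ε i))
    {V : ValuationSubring K} {B : Set F} {B' : Set K} (hB : ∀ b ∈ B, algebraMap F K b ∈ B')
    {κ : F} (hκ : κ ∈ kaehlerDets k ε (V.comap (algebraMap F K)) B) :
    algebraMap F K κ * ε'.det e' ∈ kaehlerDets k ε' V B' := by
  obtain ⟨η, hη, rfl⟩ := hκ
  refine ⟨fun i => KaehlerDifferential.map k k F K (η i), fun i => ?_, ?_⟩
  · beta_reduce
    have := hη i
    generalize η i = x at this ⊢
    induction this using Submodule.span_induction with
    | mem x hx =>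
      obtain ⟨b, hb, rfl⟩ := hx
      exact Submodule.subset_span ⟨_, hB b hb, (KaehlerDifferential.map_D k k F K b).symm⟩
    | zero => simp [zero_mem]
    | add x y _ _ hx hy => simpa using add_mem hx hy
    | smul a x _ hx =>
      have h : a • x = (a : F) • x := rfl
      have h' := Submodule.smul_mem _ (⟨algebraMap F K a, a.2⟩ : V.toSubring) hx
      rw [h, map_smul]
      convert h' using 1
      exact algebra_compatible_smul K (a : F) _
  · have hr (x : Ω[F⁄k]) (i) : e'.repr (KaehlerDifferential.map k k F K x) i
        = algebraMap F K (ε.repr x i) := by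
      conv_lhs => rw [← ε.sum_repr x]
      rw [map_sum]
      simp only [map_smul, ← he', algebra_compatible_smul K (ε.repr x _)]
      rw [e'.repr_sum_self]
    have hdet : e'.det (fun i => KaehlerDifferential.map k k F K (η i))
        = algebraMap F K (ε.det η) := by
      rw [Module.Basis.det_apply, Module.Basis.det_apply, RingHom.map_det]
      congr 1
      ext i j
      exact hr _ _
    rw [← hdet, mul_comm, Module.Basis.det_apply, Module.Basis.det_apply, Module.Basis.det_apply,
      ← Matrix.det_mul, ← Module.Basis.toMatrix_mul_toMatrix ε' e']

end kaehlerDets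

/-- A pole bound for determinants of differentials, given finitely many charts with finitely
generated coordinate rings, and sufficiently many sections with poles controlled by powers of
`f / ℓ V ^ m`. -/
lemma exists_hasPoleBound {k K ι J : Type*} [Field k] [Field K] [Algebra k K] [Fintype ι]
    [DecidableEq ι] [Finite J] (ε : Module.Basis ι K Ω[K⁄k]) (B : ValuationSubring K → Set K)
    (S : J → Subalgebra k K) (hS : ∀ j, (S j).FG)
    (hB : ∀ V : ValuationSubring K, (∀ c : k, algebraMap k K c ∈ V) →
      ∃ j, (∀ a ∈ S j, a ∈ V) ∧ ∀ b ∈ B V, ∃ p ∈ S j, ∃ q ∈ S j, q ≠ 0 ∧ q⁻¹ ∈ V ∧ b = p / q)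
    (ℓ : ValuationSubring K → K) {f : K} (hf : f ≠ 0) {m : ℕ}
    (hρ : ∀ ρ : K, ∃ w : K, w ≠ 0 ∧ ∃ e : ℕ, ∀ V : ValuationSubring K,
      (∀ c : k, algebraMap k K c ∈ V) →
        w * f ^ e / ℓ V ^ (m * e) ∈ V ∧ w * ρ * f ^ e / ℓ V ^ (m * e) ∈ V) :
    ∃ N, HasPoleBound k (fun V => kaehlerDets k ε V (B V)) ℓ N 1 := by
  classical
  have hR (R : Finset K) : ∃ w : K, w ≠ 0 ∧ ∃ e : ℕ, ∀ V : ValuationSubring K,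
      (∀ c : k, algebraMap k K c ∈ V) →
        w * f ^ e / ℓ V ^ (m * e) ∈ V ∧ ∀ ρ ∈ R, w * ρ * f ^ e / ℓ V ^ (m * e) ∈ V := by
    induction R using Finset.induction_on with
    | empty => exact ⟨1, one_ne_zero, 0, fun V _ => by simp [one_mem]⟩
    | insert ρ R _ ih =>
      obtain ⟨w, hw, e, H⟩ := ih
      obtain ⟨w', hw', e', H'⟩ := hρ ρ
      refine ⟨w * w', mul_ne_zero hw hw', e + e', fun V hV => ?_⟩
      obtain ⟨h1, h2⟩ := H V hV
      obtain ⟨h3, h4⟩ := H' V hV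
      simp only [Finset.forall_mem_insert]
      refine ⟨?_, ?_, fun ρ' hρ' => ?_⟩
      · convert mul_mem h1 h3 using 1
        ring
      · convert mul_mem h1 h4 using 1
        ring
      · convert mul_mem (h2 ρ' hρ') h3 using 1
        ring
  choose G hG using hS
  have hfin : (⋃ j, ⋃ x ∈ G j, Set.range fun i =>
      ε.repr (KaehlerDifferential.D k K x) i).Finite :=
    Set.finite_iUnion fun j => (G j).finite_toSet.biUnion fun x _ => Set.finite_range _
  obtain ⟨w, hw, e, H⟩ := hR hfin.toFinset
  refine ⟨m * e * Fintype.card ι, (w * f ^ e) ^ Fintype.card ι, by positivity,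
    fun V hV κ hκ => ?_⟩
  obtain ⟨j, hj, hBj⟩ := hB V hV
  have hGj : ∀ x ∈ S j, ∀ i, w * f ^ e / ℓ V ^ (m * e) *
      ε.repr (KaehlerDifferential.D k K x) i ∈ V := by
    intro x hx
    rw [← hG j] at hx
    induction hx using Algebra.adjoin_induction with
    | mem x hx =>
      intro i
      convert (H V hV).2 (ε.repr (KaehlerDifferential.D k K x) i) ?_ using 1
      · ring
      · simp only [Set.Finite.mem_toFinset, Set.mem_iUnion]
        exact ⟨j, x, hx, i, rfl⟩
    | algebraMap r => intro i; simp [zero_mem]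
    | add x y _ _ hx hy => intro i; simpa [mul_add] using add_mem (hx i) (hy i)
    | mul x y hx' hy' hx hy =>
      intro i
      rw [hG j] at hx' hy'
      convert add_mem (mul_mem (hj x hx') (hy i)) (mul_mem (hj y hy') (hx i)) using 1
      simp only [Derivation.leibniz, map_add, map_smul, Finsupp.add_apply, Finsupp.smul_apply,
        smul_eq_mul]
      ring
  have hz : ∀ b ∈ B V, ∀ i, w * f ^ e / ℓ V ^ (m * e) *
      ε.repr (KaehlerDifferential.D k K b) i ∈ V := by
    intro b hb i
    obtain ⟨p, hp, q, hq, hq0, hqV, rfl⟩ := hBj b hb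
    convert add_mem (mul_mem hqV (hGj p hp i))
      (neg_mem (mul_mem (mul_mem (hj p hp) (pow_mem hqV 2)) (hGj q hq i))) using 1
    rw [Derivation.leibniz_div]
    simp only [map_sub, map_smul, Finsupp.sub_apply, Finsupp.smul_apply, smul_eq_mul]
    field_simp
    ring
  convert pow_mul_mem_of_mem_kaehlerDets ε hz hκ using 1
  rw [div_pow, ← pow_mul (ℓ V)]
  ring

section FunctionField

open LineBundle

variable {X : Scheme.{u}} [IsIntegral X]

lemma sres_self {X : Scheme.{u}} {U : X.Opens} (a : Γ(X, U)) : sres X le_rfl a = a :=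
  congrArg (fun f => f.hom a) (X.presheaf.map_id (op U))

/-- The inclusion of the ring of sections over an open set containing the generic point into the
function field. -/
def toFunctionField (X : Scheme.{u}) [IsIntegral X] (U : X.Opens) (hU : genericPoint X ∈ U) :
    Γ(X, U) →+* X.functionField :=
  (X.presheaf.germ U _ hU).hom

lemma genericPoint_mem {U : X.Opens} {x : X} (hx : x ∈ U) : genericPoint X ∈ U :=
  ((genericPoint_spec X).mem_open_set_iff U.isOpen).mpr ⟨x, trivial, hx⟩

lemma toFunctionField_injective (U : X.Opens) (hU : genericPoint X ∈ U) :
    Function.Injective (toFunctionField X U hU) :=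
  germ_injective_of_isIntegral _ _ _

lemma toFunctionField_sres {V U : X.Opens} (h : V ≤ U) (hV : genericPoint X ∈ V) (a : Γ(X, U)) :
    toFunctionField X V hV (sres X h a) = toFunctionField X U (h hV) a :=
  X.presheaf.germ_res_apply (homOfLE h) _ hV a

/-- The function field of a scheme over `k` as an extension of `k`. -/
def baseToFunctionField {k : Type u} [Field k] (sX : X ⟶ Spec (CommRingCat.of k)) :
    k →+* X.functionField :=
  (toFunctionField X ⊤ trivial).comp (toSections sX ⊤)

variable {k : Type u} [Field k] (sX : X ⟶ Spec (CommRingCat.of k))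

lemma toFunctionField_toSections {U : X.Opens} (hU : genericPoint X ∈ U) (c : k) :
    toFunctionField X U hU (toSections sX U c) = baseToFunctionField sX c := by
  rw [← sres_toSections sX (le_top : U ≤ ⊤), toFunctionField_sres]
  rfl

lemma fromSpecStalk_genericPoint_comp :
    X.fromSpecStalk (genericPoint X) ≫ sX =
      Spec.map (CommRingCat.ofHom (baseToFunctionField sX)) := by
  refine ext_of_isAffine ?_
  have h1 : (X.fromSpecStalk (genericPoint X)).appTop =
      X.presheaf.germ ⊤ (genericPoint X) trivial ≫ (Scheme.ΓSpecIso X.functionField).inv := by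
    rw [Scheme.Hom.appTop, X.fromSpecStalk_app (U := ⊤) trivial]
    exact congrArg _ ((congrArg _ (CategoryTheory.Functor.map_id _ _)).trans (Category.comp_id _))
  rw [Scheme.Hom.comp_appTop, h1, ← cancel_epi (Scheme.ΓSpecIso _).inv,
    ← Scheme.ΓSpecIso_inv_naturality, ← Category.assoc, ← Category.assoc]
  congr 1
  ext c
  change X.presheaf.germ ⊤ _ trivial _ = X.presheaf.germ ⊤ _ trivial (sres X le_rfl _)
  exact congrArg (X.presheaf.germ ⊤ _ trivial) (sres_self _).symm

/-- The center of a valuation ring of the function field of `X`. -/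
def IsCenter (V : ValuationSubring X.functionField) (x : X) : Prop :=
  ∃ l : Spec (CommRingCat.of V) ⟶ X,
    Spec.map (CommRingCat.ofHom (algebraMap V X.functionField)) ≫ l
      = X.fromSpecStalk (genericPoint X) ∧ l (IsLocalRing.closedPoint V) = x

lemma exists_isCenter [IsProper sX] {V : ValuationSubring X.functionField}
    (hV : ∀ c, baseToFunctionField sX c ∈ V) : ∃ x, IsCenter V x := by
  have h := ‹IsProper sX›
  rw [IsProper.eq_valuativeCriterion] at h
  let S : ValuativeCommSq sX :=
    { R := V
      K := X.functionField
      i₁ := X.fromSpecStalk (genericPoint X)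
      i₂ := Spec.map (CommRingCat.ofHom ((baseToFunctionField sX).codRestrict V.toSubring hV))
      commSq := ⟨by
        rw [fromSpecStalk_genericPoint_comp, ← Spec.map_comp]
        rfl⟩ }
  obtain ⟨⟨l, hl, _⟩⟩ := (h.1.1.1.existence S).exists_lift
  exact ⟨_, l, hl, rfl⟩

lemma IsCenter.exists_isLocalHom {V : ValuationSubring X.functionField} {x : X}
    (h : IsCenter V x) : ∃ r : X.presheaf.stalk x →+* V, IsLocalHom r ∧
      ∀ (U : X.Opens) (hx : x ∈ U) (a : Γ(X, U)),
        toFunctionField X U (genericPoint_mem hx) a = r (X.presheaf.germ U x hx a) := by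
  obtain ⟨l, hl, rfl⟩ := h
  have hs : genericPoint X ⤳ l (IsLocalRing.closedPoint V) := genericPoint_specializes _
  rw [← Scheme.Spec_stalkClosedPointTo_fromSpecStalk l,
    ← X.SpecMap_stalkSpecializes_fromSpecStalk hs,
    ← Category.assoc, cancel_mono, ← Spec.map_comp, Spec.map_inj] at hl
  refine ⟨(Scheme.stalkClosedPointTo l).hom, inferInstance, fun U hx a => ?_⟩
  have h1 := congrArg (fun f => f.hom (X.presheaf.germ U _ hx a)) hl
  have h2 := X.presheaf.germ_stalkSpecializes_apply hx hs a
  exact h2.symm.trans h1.symm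

lemma IsCenter.mem {V : ValuationSubring X.functionField} {x : X} (h : IsCenter V x)
    {U : X.Opens} (hx : x ∈ U) (a : Γ(X, U)) : toFunctionField X U (genericPoint_mem hx) a ∈ V := by
  obtain ⟨r, -, hr⟩ := h.exists_isLocalHom
  rw [hr U hx]
  exact Subtype.prop _

lemma IsCenter.mem_basicOpen {V : ValuationSubring X.functionField} {x : X} (h : IsCenter V x)
    {U : X.Opens} (hx : x ∈ U) {a : Γ(X, U)}
    (h0 : toFunctionField X U (genericPoint_mem hx) a ≠ 0)
    (ha : (toFunctionField X U (genericPoint_mem hx) a)⁻¹ ∈ V) : x ∈ X.basicOpen a := by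
  obtain ⟨r, _, hr⟩ := h.exists_isLocalHom
  rw [Scheme.mem_basicOpen X a x hx]
  refine isUnit_of_map_unit r _ (.of_mul_eq_one ⟨_, ha⟩ (Subtype.ext ?_))
  change (r _ : X.functionField) * _ = 1
  rw [← hr, mul_inv_cancel₀ h0]

lemma IsCenter.ne_zero_and_inv_mem {V : ValuationSubring X.functionField} {x : X}
    (h : IsCenter V x) {U : X.Opens} {a : Γ(X, U)} (hx : x ∈ X.basicOpen a)
    (hU : genericPoint X ∈ U) :
    toFunctionField X U hU a ≠ 0 ∧ (toFunctionField X U hU a)⁻¹ ∈ V := by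
  obtain ⟨r, _, hr⟩ := h.exists_isLocalHom
  have hxU := X.basicOpen_le a hx
  obtain ⟨b, hb⟩ := (((Scheme.mem_basicOpen X a x hxU).1 hx).map r).exists_right_inv
  have h1 : toFunctionField X U hU a * b = 1 := by
    rw [hr U hxU]
    exact congrArg Subtype.val hb
  refine ⟨left_ne_zero_of_mul_eq_one h1, ?_⟩
  rw [inv_eq_of_mul_eq_one_right h1]
  exact b.2

include sX in
lemma IsCenter.mem_of_isAffineOpen [IsSeparated sX] {V : ValuationSubring X.functionField} {x : X}
    (h : IsCenter V x) {U : X.Opens} (hU : IsAffineOpen U) (hg : genericPoint X ∈ U)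
    (H : ∀ a, toFunctionField X U hg a ∈ V) : x ∈ U := by
  obtain ⟨l, hl, rfl⟩ := h
  set i := CommRingCat.ofHom (algebraMap V X.functionField)
  obtain ⟨l', h0⟩ : ∃ l' : Spec (CommRingCat.of V) ⟶ X, l' =
      Spec.map (CommRingCat.ofHom ((toFunctionField X U hg).codRestrict V.toSubring H)) ≫
        hU.fromSpec := ⟨_, rfl⟩
  have hl' : Spec.map i ≫ l' = X.fromSpecStalk (genericPoint X) := by
    rw [← hU.fromSpecStalk_eq_fromSpecStalk hg, IsAffineOpen.fromSpecStalk, h0, ← Category.assoc,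
      ← Spec.map_comp]
    rfl
  have hs : l' ≫ sX = l ≫ sX := by
    rw [← Spec.map_preimage (l ≫ sX), ← Spec.map_preimage (l' ≫ sX), Spec.map_inj]
    have h1 : Spec.preimage (l' ≫ sX) ≫ i = Spec.preimage (l ≫ sX) ≫ i := by
      rw [← Spec.map_inj, Spec.map_comp, Spec.map_comp, Spec.map_preimage, Spec.map_preimage,
        ← Category.assoc, ← Category.assoc, hl, hl']
    ext c
    exact congrArg (fun f => f.hom c) h1
  let S : ValuativeCommSq sX :=
    { R := V
      K := X.functionField
      i₁ := X.fromSpecStalk (genericPoint X)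
      i₂ := l ≫ sX
      commSq := ⟨by rw [← hl, Category.assoc]⟩ }
  have := congrArg CommSq.LiftStruct.l (((IsSeparated.valuativeCriterion sX) S).elim
    ⟨l, hl, rfl⟩ ⟨l', hl', hs⟩)
  change l = l' at this
  rw [this, h0, ← SetLike.mem_coe, ← hU.range_fromSpec]
  exact ⟨_, rfl⟩

end FunctionField

section Sections

open LineBundle Algebra

variable {X : Scheme.{u}} {k : Type u} [Field k] (sX : X ⟶ Spec (CommRingCat.of k))

lemma toSections_eq_comp (U : X.Opens) :
    toSections sX U = (sX.appLE ⊤ U le_top).hom.comp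
      (Scheme.ΓSpecIso (CommRingCat.of k)).symm.commRingCatIsoToRingEquiv.toRingHom := by
  rfl

lemma smooth_toSections [Smooth sX] {U : X.Opens} (hU : IsAffineOpen U) :
    (toSections sX U).Smooth := by
  rw [toSections_eq_comp]
  exact (RingHom.Smooth.of_bijective (RingEquiv.bijective _)).comp
    (sX.smooth_appLE (isAffineOpen_top _) hU _)

lemma finiteType_toSections [LocallyOfFiniteType sX] {U : X.Opens} (hU : IsAffineOpen U) :
    (toSections sX U).FiniteType := by
  rw [toSections_eq_comp]
  exact RingHom.FiniteType.comp (sX.finiteType_appLE (isAffineOpen_top _) hU _)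
    (RingHom.FiniteType.of_surjective _ (RingEquiv.surjective _))

include sX in
lemma isIntegrallyClosed_sections [IsIntegral X] [Smooth sX] {U : X.Opens} (hU : IsAffineOpen U)
    [Nonempty U] : IsIntegrallyClosed Γ(X, U) := by
  let := (toSections sX U).toAlgebra
  have : Algebra.Smooth k Γ(X, U) := smooth_toSections sX hU
  exact isIntegrallyClosed_of_smooth k Γ(X, U)

variable [IsIntegral X]

lemma exists_toFunctionField_eq {U : X.Opens} (hU : genericPoint X ∈ U) {z : X.functionField}
    (H : ∀ x ∈ U, ∃ (W : X.Opens) (hx : x ∈ W) (a : Γ(X, W)),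
      toFunctionField X W (genericPoint_mem hx) a = z) : ∃ a, toFunctionField X U hU a = z := by
  choose W hW a ha using H
  have hg (x : U) : genericPoint X ∈ W x x.2 := genericPoint_mem (hW x x.2)
  obtain ⟨s, hs⟩ : ∃ s : Γ(X, U), ∀ x : U,
      sres X inf_le_right s = sres X (inf_le_left : W x x.2 ⊓ U ≤ W x x.2) (a x x.2) := by
    obtain ⟨s, hs, -⟩ := X.sheaf.existsUnique_gluing' (fun x : U => W x x.2 ⊓ U) U
      (fun _ => homOfLE inf_le_right)
      (fun x hx => TopologicalSpace.Opens.mem_iSup.mpr ⟨⟨x, hx⟩, hW x hx, hx⟩)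
      (fun x => sres X inf_le_left (a x x.2)) fun x y => by
        have hgU : genericPoint X ∈ (W x x.2 ⊓ U) ⊓ (W y y.2 ⊓ U) := ⟨⟨hg x, hU⟩, ⟨hg y, hU⟩⟩
        apply toFunctionField_injective _ hgU
        change toFunctionField X _ _ (sres X inf_le_left (sres X inf_le_left _)) =
          toFunctionField X _ _ (sres X inf_le_right (sres X inf_le_left _))
        simp only [toFunctionField_sres, ha]
    exact ⟨s, hs⟩
  refine ⟨s, ?_⟩
  have h : genericPoint X ∈ W _ hU ⊓ U := ⟨hW _ hU, hU⟩
  rw [← toFunctionField_sres inf_le_right h, hs ⟨_, hU⟩, toFunctionField_sres, ha]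

lemma isIntegrallyClosedIn_functionField [Smooth sX] (U : X.Opens) [Nonempty U] :
    IsIntegrallyClosedIn Γ(X, U) X.functionField := by
  obtain ⟨y, hy⟩ := ‹Nonempty U›
  have hU := genericPoint_mem hy
  refine isIntegrallyClosedIn_iff.mpr ⟨toFunctionField_injective U hU, fun {z} hz => ?_⟩
  refine exists_toFunctionField_eq hU fun x hx => ?_
  obtain ⟨W, hW, hxW, hWU⟩ := TopologicalSpace.Opens.isBasis_iff_nbhd.mp X.isBasis_affineOpens hx
  have : Nonempty W := ⟨⟨x, hxW⟩⟩
  have := isIntegrallyClosed_sections sX hW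
  have := functionField_isFractionRing_of_isAffineOpen X W hW
  have hz' : IsIntegral Γ(X, W) z := by
    refine hz.map_of_comp_eq (sres X hWU) (RingHom.id _) ?_
    ext a
    exact toFunctionField_sres hWU (genericPoint_mem hxW) a
  obtain ⟨a, ha⟩ := IsIntegrallyClosed.isIntegral_iff.mp hz'
  exact ⟨W, hxW, a, ha⟩

/-- The function field of a scheme over `k` as a `k`-algebra. -/
abbrev functionFieldAlgebra : Algebra k X.functionField := (baseToFunctionField sX).toAlgebra

/-- The sections over an open set of a scheme over `k` as a `k`-algebra. -/
abbrev sectionsAlgebra (U : X.Opens) : Algebra k Γ(X, U) := (toSections sX U).toAlgebra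

lemma isScalarTower_functionField (U : X.Opens) [h : Nonempty U] :
    letI := functionFieldAlgebra sX
    letI := sectionsAlgebra sX U
    IsScalarTower k Γ(X, U) X.functionField := by
  let := functionFieldAlgebra sX
  let := sectionsAlgebra sX U
  exact IsScalarTower.of_algebraMap_eq fun c =>
    (toFunctionField_toSections sX (genericPoint_mem h.some.2) c).symm

lemma trdeg_functionField_le [LocallyOfFiniteType sX] {g : ℕ}
    (hdim : topologicalKrullDim X = (g : ℕ∞)) :
    letI := functionFieldAlgebra sX
    Algebra.trdeg k X.functionField ≤ g := by
  let := functionFieldAlgebra sX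
  obtain ⟨U, hU, hx, -⟩ := TopologicalSpace.Opens.isBasis_iff_nbhd.mp X.isBasis_affineOpens
    (show genericPoint X ∈ (⊤ : X.Opens) from trivial)
  have : Nonempty U := ⟨⟨_, hx⟩⟩
  let := sectionsAlgebra sX U
  have := isScalarTower_functionField sX U
  have := functionField_isFractionRing_of_isAffineOpen X U hU
  have : Algebra.FiniteType k Γ(X, U) := finiteType_toSections sX hU
  have h1 : ringKrullDim Γ(X, U) ≤ g := by
    rw [← PrimeSpectrum.topologicalKrullDim_eq_ringKrullDim Γ(X, U)]
    change topologicalKrullDim (Spec Γ(X, U)) ≤ g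
    rw [← IsHomeomorph.topologicalKrullDim_eq _ hU.isoSpec.hom.homeomorph.isHomeomorph]
    exact (topologicalKrullDim_subspace_le X U).trans hdim.le
  have h2 := trdeg_le_of_ringKrullDim_le (k := k) h1
  have : Algebra.IsAlgebraic Γ(X, U) X.functionField :=
    IsLocalization.isAlgebraic _ (nonZeroDivisors Γ(X, U))
  have : FaithfulSMul Γ(X, U) X.functionField := inferInstance
  rwa [← trdeg_add_eq k Γ(X, U) (A := X.functionField), trdeg_eq_zero (R := Γ(X, U)), add_zero]

end Sections

lemma RingHom.EssFiniteType.finite_of_isSeparable {F K : Type*} [Field F] [Field K] {f : F →+* K}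
    (hf : f.EssFiniteType) (hs : letI := f.toAlgebra
      Algebra.IsSeparable F K) : f.Finite := by
  algebraize [f]
  exact Algebra.finite_of_essFiniteType_of_isAlgebraic

section SelfMap

open LineBundle

variable {X : Scheme.{u}} [IsIntegral X] (φ : X ⟶ X) (h : φ.base (genericPoint X) = genericPoint X)

/-- The endomorphism of the function field induced by a dominant self-map. -/
def functionFieldMap : X.functionField →+* X.functionField :=
  ((X.presheaf.stalkCongr (Inseparable.of_eq h.symm)).hom ≫ φ.stalkMap (genericPoint X)).hom

include h in
lemma genericPoint_mem_preimage {U : X.Opens} (hU : genericPoint X ∈ U) :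
    genericPoint X ∈ φ ⁻¹ᵁ U := by
  change φ.base (genericPoint X) ∈ U
  rwa [h]

lemma functionFieldMap_toFunctionField {U : X.Opens} (hU : genericPoint X ∈ U) (a : Γ(X, U)) :
    functionFieldMap φ h (toFunctionField X U hU a) =
      toFunctionField X (φ ⁻¹ᵁ U) (genericPoint_mem_preimage φ h hU) (φ.app U a) := by
  have h1 := X.presheaf.germ_stalkSpecializes_apply hU (Inseparable.of_eq h.symm).specializes' a
  have h2 := φ.germ_stalkMap_apply U _ (genericPoint_mem_preimage φ h hU) a
  refine Eq.trans ?_ h2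
  exact congrArg (φ.stalkMap (genericPoint X)) h1

lemma functionFieldMap_appLE {U V : X.Opens} (hV : genericPoint X ∈ V) (e : V ≤ φ ⁻¹ᵁ U)
    (hU : genericPoint X ∈ U) (a : Γ(X, U)) :
    functionFieldMap φ h (toFunctionField X U hU a) =
      toFunctionField X V hV (φ.appLE U V e a) := by
  rw [functionFieldMap_toFunctionField, ← toFunctionField_sres e hV]
  rfl

lemma functionFieldMap_baseToFunctionField {k : Type u} [Field k]
    (sX : X ⟶ Spec (CommRingCat.of k)) (hφ : φ ≫ sX = sX) (c : k) :
    functionFieldMap φ h (baseToFunctionField sX c) = baseToFunctionField sX c := by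
  have h1 : φ.appLE ⊤ ⊤ le_top (toSections sX ⊤ c) = toSections sX ⊤ c := by
    obtain ⟨y, hy⟩ : ∃ y, (Scheme.ΓSpecIso (CommRingCat.of k)).inv c = y := ⟨_, rfl⟩
    have h2 : φ.appTop (sX.appTop y) = sX.appTop y := by
      have h4 : (φ ≫ sX).appTop y = sX.appTop y := by rw [hφ]
      exact h4
    have h3 : toSections sX ⊤ c = sX.appTop y := by
      rw [← hy]
      exact sres_self _
    rw [h3]
    exact (sres_self (X := X) _).trans h2
  have h5 := functionFieldMap_appLE φ h (U := ⊤) (V := ⊤) (TopologicalSpace.Opens.mem_top _) le_top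
    (TopologicalSpace.Opens.mem_top _) (toSections sX ⊤ c)
  rwa [h1] at h5

lemma finite_functionFieldMap [LocallyOfFiniteType φ]
    (hs : letI := (functionFieldMap φ h).toAlgebra
      Algebra.IsSeparable X.functionField X.functionField) : (functionFieldMap φ h).Finite := by
  have h1 : (functionFieldMap φ h).EssFiniteType := by
    refine RingHom.EssFiniteType.comp ?_ (LocallyOfFiniteType.stalkMap φ (genericPoint X))
    exact RingHom.FiniteType.essFiniteType (RingHom.FiniteType.of_surjective _
      (ConcreteCategory.bijective_of_isIso
        (X.presheaf.stalkCongr (Inseparable.of_eq h.symm)).hom).2)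
  exact h1.finite_of_isSeparable hs

end SelfMap

section Center

variable {X : Scheme.{u}} [IsIntegral X] {k : Type u} [Field k] (sX : X ⟶ Spec (CommRingCat.of k))
  [IsSeparated sX]

include sX in
lemma IsCenter.mem_of_forall_mem {V : ValuationSubring X.functionField} {x : X} (h : IsCenter V x)
    {U : X.Opens} {y : X} (hy : y ∈ U)
    (H : ∀ (W : X.Opens) (hW : y ∈ W) (_ : W ≤ U) (a : Γ(X, W)),
      toFunctionField X W (genericPoint_mem hW) a ∈ V) : x ∈ U := by
  obtain ⟨W, hW, hyW, hWU⟩ := exists_isAffineOpen_mem_and_subset (X := X) hy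
  exact hWU (h.mem_of_isAffineOpen sX hW (genericPoint_mem hyW) (H W hyW hWU))

include sX in
lemma IsCenter.mem_of_le {V V' : ValuationSubring X.functionField} {x x' : X} (h : IsCenter V x)
    (h' : IsCenter V' x') (hV : V ≤ V') {U : X.Opens} (hx : x ∈ U) : x' ∈ U :=
  h'.mem_of_forall_mem sX hx fun _ hW _ a => hV (h.mem hW a)

variable (φ : X ⟶ X) (hg : φ.base (genericPoint X) = genericPoint X)

include sX in
lemma IsCenter.mem_of_comap {V : ValuationSubring X.functionField} {x y : X} (h : IsCenter V x)
    (h' : IsCenter (V.comap (functionFieldMap φ hg)) y) {U : X.Opens} (hx : φ x ∈ U) : y ∈ U := by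
  refine h'.mem_of_forall_mem sX hx fun W hW _ a => ?_
  rw [ValuationSubring.mem_comap, functionFieldMap_toFunctionField]
  exact h.mem (U := φ ⁻¹ᵁ W) hW _

include sX in
lemma IsCenter.map_mem {V : ValuationSubring X.functionField} {x y : X} (h : IsCenter V x)
    (h' : IsCenter (V.comap (functionFieldMap φ hg)) y) {U : X.Opens} (hy : y ∈ U) : φ x ∈ U := by
  obtain ⟨W, hW, hxW, -⟩ := exists_isAffineOpen_mem_and_subset (X := X) (U := ⊤) (x := φ x) trivial
  have hyW := h.mem_of_comap sX φ hg h' hxW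
  obtain ⟨q, hqU, hyq⟩ := hW.exists_basicOpen_le ⟨y, hy⟩ hyW
  obtain ⟨h0, h1⟩ := h'.ne_zero_and_inv_mem hyq (genericPoint_mem hyW)
  rw [ValuationSubring.mem_comap, map_inv₀, functionFieldMap_toFunctionField] at h1
  have h2 := h.mem_basicOpen (U := φ ⁻¹ᵁ W) hxW (a := φ.app W q) ?_ h1
  · rw [← Scheme.preimage_basicOpen] at h2
    exact hqU h2
  · rw [← functionFieldMap_toFunctionField φ hg (genericPoint_mem hyW)]
    exact (map_ne_zero _).2 h0

/-- The local ring of `X` at the center of a valuation ring, inside the function field. -/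
def centerSections (V : ValuationSubring X.functionField) : Set X.functionField :=
  {b | ∃ x, IsCenter V x ∧ ∃ (U : X.Opens) (hx : x ∈ U) (a : Γ(X, U)),
    toFunctionField X U (genericPoint_mem hx) a = b}

include sX in
lemma centerSections_mono {V V' : ValuationSubring X.functionField} {x : X} (h : IsCenter V' x)
    (hV : V ≤ V') : centerSections V ⊆ centerSections V' := by
  rintro b ⟨y, hy, U, hyU, a, rfl⟩
  exact ⟨x, h, U, hy.mem_of_le sX h hV hyU, a, rfl⟩

include sX in
lemma functionFieldMap_mem_centerSections {V : ValuationSubring X.functionField} {x : X}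
    (h : IsCenter V x) {b : X.functionField}
    (hb : b ∈ centerSections (V.comap (functionFieldMap φ hg))) :
    functionFieldMap φ hg b ∈ centerSections V := by
  obtain ⟨y, hy, U, hyU, a, rfl⟩ := hb
  exact ⟨x, h, φ ⁻¹ᵁ U, h.map_mem sX φ hg hy hyU, φ.app U a,
    (functionFieldMap_toFunctionField φ hg (genericPoint_mem hyU) a).symm⟩

end Center

section Proper

lemma degreeZeroInclusion_bijective (k : Type u) [Field k] (N : ℕ) :
    Function.Bijective (degreeZeroInclusion k N) := by
  refine ⟨fun a b h => MvPolynomial.C_injective (Fin (N + 1)) k (congrArg Subtype.val h),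
    fun ⟨p, hp⟩ => ?_⟩
  have hp' : p.totalDegree = 0 :=
    Nat.le_zero.1 (((MvPolynomial.mem_homogeneousSubmodule 0 p).1 hp).totalDegree_le)
  exact ⟨p.coeff 0, Subtype.ext (MvPolynomial.totalDegree_eq_zero_iff_eq_C.1 hp').symm⟩

lemma isProper_projSpace_str (k : Type u) [Field k] (N : ℕ) : IsProper (ProjSpace.str k N) := by
  let e := RingEquiv.ofBijective _ (degreeZeroInclusion_bijective k N)
  have : IsIso (Spec.map (CommRingCat.ofHom (degreeZeroInclusion k N))) :=
    inferInstanceAs (IsIso (Spec.map e.toCommRingCatIso.hom))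
  have : Algebra.FiniteType (MvPolynomial.homogeneousSubmodule (Fin (N + 1)) k 0)
      (MvPolynomial (Fin (N + 1)) k) := by
    rw [← RingHom.finiteType_algebraMap]
    refine RingHom.FiniteType.of_comp_finiteType (f := degreeZeroInclusion k N) ?_
    exact RingHom.finiteType_algebraMap.2
      (inferInstanceAs (Algebra.FiniteType k (MvPolynomial (Fin (N + 1)) k)))
  have h1 : IsProper (Proj.toSpecZero (MvPolynomial.homogeneousSubmodule (Fin (N + 1)) k)) :=
    inferInstance
  have h2 : IsProper (Spec.map (CommRingCat.ofHom (degreeZeroInclusion k N))) := inferInstance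
  exact MorphismProperty.comp_mem _ _ _ h1 h2

lemma IsProjectiveVariety.isProper {k : Type u} [Field k] {X : Scheme.{u}}
    {sX : X ⟶ Spec (CommRingCat.of k)} (h : IsProjectiveVariety sX) : IsProper sX := by
  obtain ⟨-, N, ι, hι, rfl⟩ := h
  have := isProper_projSpace_str k N
  infer_instance

end Proper

section Generator

open LineBundle

variable {X : Scheme.{u}} [IsIntegral X] (L : LineBundle X)

omit [IsIntegral X] in
lemma LineBundle.exists_mem (x : X) : ∃ i, x ∈ L.U i := by
  have h : x ∈ iSup L.U := L.covers ▸ TopologicalSpace.Opens.mem_top x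
  exact TopologicalSpace.Opens.mem_iSup.1 h

open Classical in
/-- The transition unit of a line bundle, as an element of the function field. -/
def LineBundle.transition (i j : L.ι) : X.functionField :=
  if h : genericPoint X ∈ L.U i ⊓ L.U j then toFunctionField X _ h (L.t i j) else 1

lemma LineBundle.transition_eq {i j : L.ι} (h : genericPoint X ∈ L.U i ⊓ L.U j) :
    L.transition i j = toFunctionField X _ h (L.t i j) :=
  dif_pos h

lemma LineBundle.transition_ne_zero (i j : L.ι) : L.transition i j ≠ 0 := by
  rw [LineBundle.transition]
  split_ifs with h
  · exact ((L.t i j).isUnit.map (toFunctionField X _ h)).ne_zero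
  · exact one_ne_zero

lemma LineBundle.transition_mul {i j l : L.ι} (hi : genericPoint X ∈ L.U i)
    (hj : genericPoint X ∈ L.U j) (hl : genericPoint X ∈ L.U l) :
    L.transition i j * L.transition j l = L.transition i l := by
  have h : genericPoint X ∈ L.U i ⊓ L.U j ⊓ L.U l := ⟨⟨hi, hj⟩, hl⟩
  have h1 := congrArg (fun u => toFunctionField X _ h (Units.val u)) (L.cocycle i j l)
  rw [L.transition_eq ⟨hi, hj⟩, L.transition_eq ⟨hj, hl⟩, L.transition_eq ⟨hi, hl⟩,
    ← toFunctionField_sres (V := L.U i ⊓ L.U j ⊓ L.U l) inf_le_left h,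
    ← toFunctionField_sres (V := L.U i ⊓ L.U j ⊓ L.U l)
      (le_inf (inf_le_left.trans inf_le_right) inf_le_right) h,
    ← toFunctionField_sres (V := L.U i ⊓ L.U j ⊓ L.U l)
      (le_inf (inf_le_left.trans inf_le_left) inf_le_right) h, ← map_mul]
  exact h1

/-- A rational section of a line bundle, expressed by its inverse values in the local
trivializations. -/
def LineBundle.gen (i : L.ι) : X.functionField :=
  L.transition (L.exists_mem (genericPoint X)).choose i

lemma LineBundle.gen_ne_zero (i : L.ι) : L.gen i ≠ 0 := L.transition_ne_zero _ _

lemma LineBundle.gen_mul_transition {i j : L.ι} (hi : genericPoint X ∈ L.U i)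
    (hj : genericPoint X ∈ L.U j) : L.gen i * L.transition i j = L.gen j :=
  L.transition_mul (L.exists_mem (genericPoint X)).choose_spec hi hj

lemma LineBundle.gen_div_gen_mem {V : ValuationSubring X.functionField} {x : X}
    (h : IsCenter V x) {i j : L.ι} (hi : x ∈ L.U i) (hj : x ∈ L.U j) : L.gen j / L.gen i ∈ V := by
  rw [← L.gen_mul_transition (genericPoint_mem hi) (genericPoint_mem hj),
    mul_div_cancel_left₀ _ (L.gen_ne_zero i), L.transition_eq (genericPoint_mem ⟨hi, hj⟩)]
  exact h.mem (U := L.U i ⊓ L.U j) ⟨hi, hj⟩ _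

lemma LineBundle.mul_gen_pow_eq {m : ℕ} {s : ∀ i, Γ(X, L.U i)}
    (hs : ∀ i j, sres X (inf_le_left : L.U i ⊓ L.U j ≤ L.U i) (s i)
      = ((L.t i j ^ m : (Γ(X, L.U i ⊓ L.U j))ˣ) : Γ(X, L.U i ⊓ L.U j)) * sres X inf_le_right (s j))
    {i j : L.ι} (hi : genericPoint X ∈ L.U i) (hj : genericPoint X ∈ L.U j) :
    toFunctionField X _ hi (s i) * L.gen i ^ m = toFunctionField X _ hj (s j) * L.gen j ^ m := by
  have h : genericPoint X ∈ L.U i ⊓ L.U j := ⟨hi, hj⟩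
  have h1 := congrArg (toFunctionField X _ h) (hs i j)
  rw [map_mul, toFunctionField_sres, toFunctionField_sres] at h1
  have h2 : toFunctionField X _ h ((L.t i j ^ m : (Γ(X, L.U i ⊓ L.U j))ˣ) : Γ(X, L.U i ⊓ L.U j)) =
      L.transition i j ^ m := by
    rw [L.transition_eq h, ← map_pow]
    rfl
  rw [h1, h2, ← L.gen_mul_transition hi hj]
  ring

lemma LineBundle.exists_generator [CompactSpace X] {k : Type u} [Field k]
    (sX : X ⟶ Spec (CommRingCat.of k)) [IsSeparated sX] :
    ∃ ℓ : ValuationSubring X.functionField → X.functionField, (Set.range ℓ).Finite ∧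
      (∀ V, ℓ V ≠ 0) ∧ ∀ V x, IsCenter V x → ∃ i, x ∈ L.U i ∧ ℓ V = L.gen i := by
  classical
  obtain ⟨F, hF⟩ := isCompact_univ.elim_finite_subcover (fun i => (L.U i : Set X))
    (fun i => (L.U i).isOpen) fun x _ => Set.mem_iUnion.2 (L.exists_mem x)
  have hF' (x : X) : ∃ i ∈ F, x ∈ L.U i := by simpa using hF (Set.mem_univ x)
  choose a haF ha using hF'
  refine ⟨fun V => if h : ∃ x, IsCenter V x then L.gen (a h.choose) else 1, ?_, fun V => ?_,
    fun V x hx => ?_⟩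
  · refine ((F.finite_toSet.image L.gen).union (Set.finite_singleton 1)).subset ?_
    rintro - ⟨V, rfl⟩
    dsimp only
    split_ifs with h
    · exact .inl ⟨_, haF _, rfl⟩
    · exact .inr rfl
  · dsimp only
    split_ifs with h
    · exact L.gen_ne_zero _
    · exact one_ne_zero
  · have h : ∃ x, IsCenter V x := ⟨x, hx⟩
    exact ⟨_, h.choose_spec.mem_of_le sX hx le_rfl (ha _), dif_pos h⟩

lemma LineBundle.exists_pullback_factor {k : Type u} [Field k]
    (sX : X ⟶ Spec (CommRingCat.of k)) [IsSeparated sX] (φ : X ⟶ X)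
    (hg : φ.base (genericPoint X) = genericPoint X) {d : ℕ}
    (hpull : (pullbackLB φ L).EquivLB (L.pow d)) :
    ∃ u : X.functionField, u ≠ 0 ∧ ∀ V x y, IsCenter V x →
      IsCenter (V.comap (functionFieldMap φ hg)) y → ∀ i j, x ∈ L.U i → y ∈ L.U j →
        u * L.gen i ^ d / functionFieldMap φ hg (L.gen j) ∈ V := by
  obtain ⟨κ, V, hV, a, b, ha, hb, s, hs⟩ := hpull
  have hV' (x : X) : ∃ c, x ∈ V c := by
    have h : x ∈ iSup V := hV ▸ TopologicalSpace.Opens.mem_top x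
    exact TopologicalSpace.Opens.mem_iSup.1 h
  set E := functionFieldMap φ hg with hE
  have hga (c) (hc : genericPoint X ∈ V c) : genericPoint X ∈ L.U (a c) := by
    have := ha c hc
    change φ.base (genericPoint X) ∈ L.U (a c) at this
    rwa [hg] at this
  have h1 (c c') (hc : genericPoint X ∈ V c) (hc' : genericPoint X ∈ V c') :
      E (L.transition (a c) (a c')) * toFunctionField X _ hc' (s c') =
        toFunctionField X _ hc (s c) * L.transition (b c) (b c') ^ d := by
    have hcc : genericPoint X ∈ V c ⊓ V c' := ⟨hc, hc'⟩
    have h2 := congrArg (fun u => toFunctionField X _ hcc (Units.val u)) (hs c c')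
    have h3 : E (L.transition (a c) (a c')) = toFunctionField X _ hcc (sres X
        (le_inf ((inf_le_left.trans (ha c))) (inf_le_right.trans (ha c')))
          ((pullbackLB φ L).t (a c) (a c')).val) := by
      rw [L.transition_eq ⟨hga c hc, hga c' hc'⟩, toFunctionField_sres]
      exact functionFieldMap_appLE φ hg _ _ _ _
    have h4 : L.transition (b c) (b c') ^ d = toFunctionField X _ hcc (sres X
        (le_inf ((inf_le_left.trans (hb c))) (inf_le_right.trans (hb c')))
          ((L.pow d).t (b c) (b c')).val) := by
      rw [L.transition_eq ⟨hb c hc, hb c' hc'⟩, toFunctionField_sres, ← map_pow]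
      rfl
    rw [h3, h4, ← toFunctionField_sres (V := V c ⊓ V c') inf_le_left hcc,
      ← toFunctionField_sres (V := V c ⊓ V c') inf_le_right hcc, ← map_mul, ← map_mul]
    exact h2
  obtain ⟨c₀, hc₀⟩ := hV' (genericPoint X)
  have hE0 (i) : E (L.gen i) ≠ 0 := (map_ne_zero E).2 (L.gen_ne_zero i)
  refine ⟨E (L.gen (a c₀)) * toFunctionField X _ hc₀ (s c₀) / L.gen (b c₀) ^ d, ?_,
    fun V' x y hx hy i j hi hj => ?_⟩
  · exact div_ne_zero (mul_ne_zero (hE0 _)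
      (((s c₀).isUnit.map (toFunctionField X _ hc₀)).ne_zero)) (pow_ne_zero _ (L.gen_ne_zero _))
  · obtain ⟨c, hxc⟩ := hV' x
    have hc := genericPoint_mem hxc
    have hya : y ∈ L.U (a c) := hx.mem_of_comap sX φ hg hy (ha c hxc)
    have h2 := h1 c c₀ hc hc₀
    have h3 : toFunctionField X _ hc (s c) * (L.gen i / L.gen (b c)) ^ d *
        E (L.gen (a c) / L.gen j) ∈ V' :=
      mul_mem (mul_mem (hx.mem hxc _) (pow_mem (L.gen_div_gen_mem hx (hb c hxc) hi) d))
        (L.gen_div_gen_mem hy hj hya)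
    convert h3 using 1
    rw [← L.gen_mul_transition (hga c hc) (hga c₀ hc₀), map_mul, mul_assoc (E _), h2,
      ← L.gen_mul_transition (hb c hc) (hb c₀ hc₀), map_div₀]
    generalize E (L.gen (a c)) = p, E (L.gen j) = q, toFunctionField X _ hc (s c) = r
    have h3 := L.gen_ne_zero (b c)
    have h4 := L.transition_ne_zero (b c) (b c₀)
    rw [mul_pow, div_pow]
    field_simp

end Generator

section AffinePole

open LineBundle

variable {X : Scheme.{u}} [IsIntegral X]

lemma AlgebraicGeometry.IsAffineOpen.exists_pow_mul_eq {U W : X.Opens} (hU : IsAffineOpen U)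
    {s : Γ(X, U)}
    (hs : genericPoint X ∈ X.basicOpen s) (hW : X.basicOpen s ≤ W) (a : Γ(X, W)) :
    ∃ (n : ℕ) (b : Γ(X, U)), toFunctionField X U (X.basicOpen_le s hs) b =
      toFunctionField X U (X.basicOpen_le s hs) s ^ n * toFunctionField X W (hW hs) a := by
  have := hU.isLocalization_basicOpen s
  obtain ⟨n, b, hb⟩ := IsLocalization.Away.surj s (sres X hW a)
  refine ⟨n, b, ?_⟩
  have h1 := congrArg (toFunctionField X _ hs) hb
  have h2 : ∀ c : Γ(X, U), algebraMap Γ(X, U) Γ(X, X.basicOpen s) c = sres X (X.basicOpen_le s) c :=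
    fun _ => rfl
  rw [← map_pow, map_mul, h2, h2, toFunctionField_sres, toFunctionField_sres, toFunctionField_sres,
    map_pow] at h1
  rw [← h1, mul_comm]

end AffinePole

section Ample

open LineBundle

variable {X : Scheme.{u}}

lemma LineBundle.exists_affine_cover [CompactSpace X] (L : LineBundle X) :
    ∃ (F : Finset X) (U : X → X.Opens) (i : X → L.ι), (∀ x, IsAffineOpen (U x)) ∧
      (∀ x, x ∈ U x) ∧ (∀ x, U x ≤ L.U (i x)) ∧ ∀ y, ∃ x ∈ F, y ∈ U x := by
  choose i hi using L.exists_mem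
  choose U hU hxU hUi using fun x => exists_isAffineOpen_mem_and_subset (hi x)
  obtain ⟨F, hF⟩ := isCompact_univ.elim_finite_subcover (fun x => (U x : Set X))
    (fun x => (U x).isOpen) fun x _ => Set.mem_iUnion.2 ⟨x, hxU x⟩
  exact ⟨F, U, i, hU, hxU, hUi, fun y => by simpa using hF (Set.mem_univ y)⟩

variable [IsIntegral X] {k : Type u} [Field k] (sX : X ⟶ Spec (CommRingCat.of k))

/-- The ring of sections over an open set as a subalgebra of the function field. -/
def sectionsSubalgebra (U : X.Opens) (hU : genericPoint X ∈ U) :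
    letI := functionFieldAlgebra sX
    Subalgebra k X.functionField :=
  letI := functionFieldAlgebra sX
  letI := sectionsAlgebra sX U
  AlgHom.range { toFunctionField X U hU with
    commutes' := fun c => toFunctionField_toSections sX hU c : Γ(X, U) →ₐ[k] X.functionField }

lemma fg_sectionsSubalgebra [LocallyOfFiniteType sX] {U : X.Opens} (hU : genericPoint X ∈ U)
    (hU' : IsAffineOpen U) :
    letI := functionFieldAlgebra sX
    (sectionsSubalgebra sX U hU).FG := by
  let := functionFieldAlgebra sX
  let := sectionsAlgebra sX U
  have : Algebra.FiniteType k Γ(X, U) := finiteType_toSections sX hU'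
  dsimp only [sectionsSubalgebra]
  rw [← Algebra.map_top]
  exact this.out.map _

/-- Multiplying a regular function on the affine nonvanishing locus of a section by a high power
of the section yields a function with poles bounded by the corresponding power of the line
bundle. -/
lemma LineBundle.exists_pow_mul_div_mem [IsSeparated sX] [CompactSpace X] (L : LineBundle X)
    (ℓ : ValuationSubring X.functionField → X.functionField)
    (hℓ : ∀ V x, IsCenter V x → ∃ i, x ∈ L.U i ∧ ℓ V = L.gen i) {m : ℕ} (s : ∀ i, Γ(X, L.U i))
    {Y : X.Opens} (hY : ∀ i, X.basicOpen (s i) ≤ Y) {f : X.functionField} (hf0 : f ≠ 0)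
    (hf : ∀ i (hi : genericPoint X ∈ L.U i), toFunctionField X (L.U i) hi (s i) * L.gen i ^ m = f)
    (hg : genericPoint X ∈ Y) (a : Γ(X, Y)) :
    ∃ n, ∀ e, n ≤ e → ∀ V x, IsCenter V x →
      toFunctionField X Y hg a * f ^ e / ℓ V ^ (m * e) ∈ V := by
  obtain ⟨F, U, i, hU, hxU, hUi, hF⟩ := L.exists_affine_cover
  have h1 (x : X) : ∃ (n : ℕ) (b : Γ(X, U x)), toFunctionField X _ (genericPoint_mem (hxU x)) b =
      toFunctionField X _ (hUi x (genericPoint_mem (hxU x))) (s (i x)) ^ n *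
        toFunctionField X Y hg a := by
    have hgU := genericPoint_mem (hxU x)
    have hs0 : sres X (hUi x) (s (i x)) ≠ 0 := by
      intro h0
      apply hf0
      rw [← hf (i x) (hUi x hgU), ← toFunctionField_sres (hUi x) hgU, h0, map_zero, zero_mul]
    have hs : genericPoint X ∈ X.basicOpen (sres X (hUi x) (s (i x))) := by
      refine (Scheme.mem_basicOpen X _ _ hgU).2 (isUnit_iff_ne_zero.2 ?_)
      exact (map_ne_zero_iff _ (toFunctionField_injective _ hgU)).2 hs0
    have hle := (Scheme.basicOpen_res X (s (i x)) (homOfLE (hUi x)).op).trans_le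
      (inf_le_right.trans (hY (i x)))
    obtain ⟨n, b, hb⟩ := (hU x).exists_pow_mul_eq hs hle a
    rw [toFunctionField_sres] at hb
    exact ⟨n, b, hb⟩
  choose n b hb using h1
  refine ⟨F.sup n, fun e he V x hx => ?_⟩
  obtain ⟨y, hyF, hxy⟩ := hF x
  obtain ⟨j, hj, hℓj⟩ := hℓ V x hx
  have hy : genericPoint X ∈ L.U (i y) := genericPoint_mem (hUi y hxy)
  have h2 : toFunctionField X _ (genericPoint_mem hxy) (b y) *
      toFunctionField X _ hy (s (i y)) ^ (e - n y) * (L.gen (i y) / ℓ V) ^ (m * e) ∈ V := by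
    refine mul_mem (mul_mem (hx.mem hxy _) (pow_mem (hx.mem (hUi y hxy) _) _)) (pow_mem ?_ _)
    rw [hℓj]
    exact L.gen_div_gen_mem hx hj (hUi y hxy)
  convert h2 using 1
  have h3 : n y + (e - n y) = e := Nat.add_sub_of_le ((Finset.le_sup hyF).trans he)
  rw [hb, mul_right_comm _ _ (_ ^ (e - n y)), ← pow_add, h3, ← hf _ hy, div_pow]
  ring

lemma LineBundle.IsAmple.exists_hasPoleBound [IsProper sX] {L : LineBundle X}
    (hL : L.IsAmple) (ℓ : ValuationSubring X.functionField → X.functionField)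
    (hℓ : ∀ V x, IsCenter V x → ∃ i, x ∈ L.U i ∧ ℓ V = L.gen i) {g : ℕ} :
    letI := functionFieldAlgebra sX
    ∀ ε : Module.Basis (Fin g) X.functionField Ω[X.functionField⁄k],
      ∃ N, HasPoleBound k (fun V => kaehlerDets k ε V (centerSections V)) ℓ N 1 := by
  intro ε
  let := functionFieldAlgebra sX
  obtain ⟨_, hL⟩ := hL
  obtain ⟨m, hm, σ, hg, hY⟩ := hL (genericPoint X)
  obtain ⟨i₀, hi₀⟩ := TopologicalSpace.Opens.mem_iSup.1 hg
  have hgi₀ := X.basicOpen_le _ hi₀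
  obtain ⟨f, hf'⟩ : ∃ f, toFunctionField X (L.U i₀) hgi₀ (σ.s i₀) * L.gen i₀ ^ m = f := ⟨_, rfl⟩
  have hf (i) (hi : genericPoint X ∈ L.U i) :
      toFunctionField X (L.U i) hi (σ.s i) * L.gen i ^ m = f :=
    (L.mul_gen_pow_eq σ.compat hi hgi₀).trans hf'
  have hf0 : f ≠ 0 := by
    rw [← hf']
    refine mul_ne_zero ?_ (pow_ne_zero _ (L.gen_ne_zero _))
    exact (((Scheme.mem_basicOpen X _ _ hgi₀).1 hi₀)).ne_zero
  obtain ⟨F, U, i, hU, hxU, hUi, hF⟩ := L.exists_affine_cover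
  refine _root_.exists_hasPoleBound ε centerSections
    (fun x : F => sectionsSubalgebra sX (U x) (genericPoint_mem (hxU x)))
    (fun x => fg_sectionsSubalgebra sX _ (hU x)) (fun V hV => ?_) ℓ hf0 (m := m) fun ρ => ?_
  · obtain ⟨x, hx⟩ := exists_isCenter sX hV
    obtain ⟨y, hyF, hxy⟩ := hF x
    refine ⟨⟨y, hyF⟩, ?_, ?_⟩
    · rintro _ ⟨a, rfl⟩
      exact hx.mem hxy a
    · rintro _ ⟨x', hx', W, hx'W, a, rfl⟩
      have hx'y : x' ∈ U y := hx.mem_of_le sX hx' le_rfl hxy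
      obtain ⟨q, hqW, hx'q⟩ := (hU y).exists_basicOpen_le ⟨x', hx'W⟩ hx'y
      obtain ⟨n, p, hp⟩ := (hU y).exists_pow_mul_eq (genericPoint_mem hx'q) hqW a
      obtain ⟨hq0, hqV⟩ := hx'.ne_zero_and_inv_mem hx'q (genericPoint_mem hx'y)
      refine ⟨_, ⟨p, rfl⟩, _, ⟨q ^ n, rfl⟩, ?_, ?_, ?_⟩
      · exact (map_pow (toFunctionField X _ (genericPoint_mem hx'y)) q n).trans_ne
          (pow_ne_zero _ hq0)
      · change (toFunctionField X _ (genericPoint_mem hx'y) (q ^ n))⁻¹ ∈ V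
        rw [map_pow, ← inv_pow]
        exact pow_mem hqV n
      · change _ = toFunctionField X _ (genericPoint_mem hx'y) p /
          toFunctionField X _ (genericPoint_mem hx'y) (q ^ n)
        rw [hp, map_pow, mul_div_cancel_left₀ _ (pow_ne_zero _ hq0)]
  · have : Nonempty σ.locus := ⟨⟨_, hg⟩⟩
    have := functionField_isFractionRing_of_isAffineOpen X σ.locus hY
    obtain ⟨r, w, hw, hρ⟩ := IsFractionRing.div_surjective (A := Γ(X, σ.locus)) ρ
    have hw0 : toFunctionField X _ hg w ≠ 0 := by
      rw [Ne, map_eq_zero_iff _ (toFunctionField_injective _ hg)]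
      exact nonZeroDivisors.ne_zero hw
    have hρ' : toFunctionField X _ hg w * ρ = toFunctionField X _ hg r := by
      have h1 : toFunctionField X _ hg r / toFunctionField X _ hg w = ρ := hρ
      rw [← h1, mul_div_cancel₀ _ hw0]
    obtain ⟨n₁, h₁⟩ := L.exists_pow_mul_div_mem sX ℓ hℓ σ.s
      (fun i => le_iSup (fun i => X.basicOpen (σ.s i)) i) hf0 hf hg w
    obtain ⟨n₂, h₂⟩ := L.exists_pow_mul_div_mem sX ℓ hℓ σ.s
      (fun i => le_iSup (fun i => X.basicOpen (σ.s i)) i) hf0 hf hg r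
    refine ⟨_, hw0, max n₁ n₂, fun V hV => ?_⟩
    obtain ⟨x, hx⟩ := exists_isCenter sX hV
    rw [hρ']
    exact ⟨h₁ _ (le_max_left _ _) V x hx, h₂ _ (le_max_right _ _) V x hx⟩

end Ample

lemma Module.Basis.det_sum_smul {ι K M : Type*} [Fintype ι] [DecidableEq ι] [Field K]
    [AddCommGroup M] [Module K M] (ε : Module.Basis ι K M) (T : Matrix ι ι K) (v : ι → M) :
    ε.det (fun a => ∑ b, T a b • v b) = T.det * ε.det v := by
  rw [Module.Basis.det_apply, Module.Basis.det_apply, ← Matrix.det_transpose T, mul_comm,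
    ← Matrix.det_mul]
  congr 1
  ext i j
  simp [Module.Basis.toMatrix_apply, Matrix.mul_apply, mul_comm]

lemma KaehlerDifferential.map_map {k A C K : Type*} [CommRing k] [CommRing A] [CommRing C]
    [CommRing K] [Algebra k A] [Algebra k C] [Algebra k K] [Algebra A C] [Algebra A K] [Algebra C K]
    [IsScalarTower k A C] [IsScalarTower k A K] [IsScalarTower k C K] [IsScalarTower A C K]
    (x : Ω[A⁄k]) :
    KaehlerDifferential.map k k C K (KaehlerDifferential.map k k A C x) =
      KaehlerDifferential.map k k A K x := by
  have hx : x ∈ Submodule.span A (Set.range (KaehlerDifferential.D k A)) := by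
    rw [KaehlerDifferential.span_range_derivation]
    trivial
  induction hx using Submodule.span_induction with
  | mem x hx =>
    obtain ⟨a, rfl⟩ := hx
    rw [KaehlerDifferential.map_D, KaehlerDifferential.map_D, KaehlerDifferential.map_D,
      ← IsScalarTower.algebraMap_apply]
  | zero => simp
  | add x y _ _ hx hy => rw [map_add, map_add, hx, hy, map_add]
  | smul a x _ hx =>
    rw [LinearMap.map_smul (KaehlerDifferential.map k k A C), ← algebraMap_smul C a,
      LinearMap.map_smul, hx, algebraMap_smul, LinearMap.map_smul]

lemma KaehlerDifferential.map_mem_span {k A K : Type*} [Field k] [CommRing A] [Field K]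
    [Algebra k A] [Algebra k K] [Algebra A K] [IsScalarTower k A K] {V : ValuationSubring K}
    {B : Set K} (hV : ∀ a : A, algebraMap A K a ∈ V) (hB : ∀ a : A, algebraMap A K a ∈ B)
    (x : Ω[A⁄k]) : KaehlerDifferential.map k k A K x ∈
      Submodule.span V.toSubring (KaehlerDifferential.D k K '' B) := by
  have hx : x ∈ Submodule.span A (Set.range (KaehlerDifferential.D k A)) := by
    rw [KaehlerDifferential.span_range_derivation]
    trivial
  induction hx using Submodule.span_induction with
  | mem x hx =>
    obtain ⟨a, rfl⟩ := hx
    rw [KaehlerDifferential.map_D]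
    exact Submodule.subset_span ⟨_, hB a, rfl⟩
  | zero => simp [zero_mem]
  | add x y _ _ hx hy => rw [map_add]; exact add_mem hx hy
  | smul a x _ hx =>
    rw [map_smul, ← algebraMap_smul K a]
    exact Submodule.smul_mem _ (⟨_, hV a⟩ : V.toSubring) hx

section Canonical

open LineBundle

variable {X : Scheme.{u}} [IsIntegral X] {k : Type u} [Field k] {sX : X ⟶ Spec (CommRingCat.of k)}

lemma IsCanonicalBundle.exists_differentials {g : ℕ} {ω : LineBundle X}
    (h : IsCanonicalBundle sX g ω)
    [PerfectField k] [Smooth sX] (hdim : topologicalKrullDim X = (g : ℕ∞)) :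
    letI := functionFieldAlgebra sX
    ∃ e : ω.ι → Fin g → Ω[X.functionField⁄k],
      (∀ i, genericPoint X ∈ ω.U i →
        ∃ b : Module.Basis (Fin g) X.functionField Ω[X.functionField⁄k], ⇑b = e i) ∧
      (∀ i V x, IsCenter V x → x ∈ ω.U i → ∀ a, e i a ∈ Submodule.span V.toSubring
        (KaehlerDifferential.D k X.functionField '' centerSections V)) ∧
      ∀ i j, genericPoint X ∈ ω.U i → genericPoint X ∈ ω.U j →
        ∃ T : Matrix (Fin g) (Fin g) X.functionField,
          (∀ a, e j a = ∑ b, T a b • e i b) ∧ T.det = ω.transition i j := by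
  let := functionFieldAlgebra sX
  let (U : X.Opens) : Algebra k Γ(X, U) := sectionsAlgebra sX U
  have htr := trdeg_functionField_le sX hdim
  have htow (U : X.Opens) [Nonempty U] : IsScalarTower k Γ(X, U) X.functionField :=
    isScalarTower_functionField sX U
  obtain ⟨e, he⟩ := h
  have h1 (i : ω.ι) : ∃ e' : Fin g → Ω[X.functionField⁄k], ∀ _ : Nonempty (ω.U i), ∀ a,
      e' a = KaehlerDifferential.map k k Γ(X, ω.U i) X.functionField (e i a) := by
    by_cases hi : Nonempty (ω.U i)
    · exact ⟨fun a => KaehlerDifferential.map k k Γ(X, ω.U i) X.functionField (e i a),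
        fun _ _ => rfl⟩
    · exact ⟨0, fun h => absurd h hi⟩
  choose e' he' using h1
  refine ⟨e', fun i hi => ?_, fun i V x hV hx a => ?_, fun i j hi hj => ?_⟩
  · have : Nonempty (ω.U i) := ⟨⟨_, hi⟩⟩
    have : FaithfulSMul Γ(X, ω.U i) X.functionField :=
      (faithfulSMul_iff_algebraMap_injective _ _).2 (toFunctionField_injective _ hi)
    have := isIntegrallyClosedIn_functionField sX (ω.U i)
    have := isFractionRing_of_basis_kaehler htr (e i)
    refine ⟨kaehlerBasisOfIsFractionRing (e i), funext fun a => ?_⟩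
    rw [kaehlerBasisOfIsFractionRing_apply, he' i ‹_› a]
  · have : Nonempty (ω.U i) := ⟨⟨_, hx⟩⟩
    rw [he' i ‹_› a]
    refine KaehlerDifferential.map_mem_span (fun a => ?_) (fun a => ?_) _
    · exact hV.mem hx a
    · exact ⟨x, hV, _, hx, a, rfl⟩
  · have h1 : Nonempty (ω.U i) := ⟨⟨_, hi⟩⟩
    have h2 : Nonempty (ω.U j) := ⟨⟨_, hj⟩⟩
    have hij : genericPoint X ∈ ω.U i ⊓ ω.U j := ⟨hi, hj⟩
    have h3 : Nonempty (ω.U i ⊓ ω.U j : X.Opens) := ⟨⟨_, hij⟩⟩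
    let : Algebra Γ(X, ω.U i) Γ(X, ω.U i ⊓ ω.U j) :=
      (sres X (inf_le_left : ω.U i ⊓ ω.U j ≤ ω.U i)).toAlgebra
    let : Algebra Γ(X, ω.U j) Γ(X, ω.U i ⊓ ω.U j) :=
      (sres X (inf_le_right : ω.U i ⊓ ω.U j ≤ ω.U j)).toAlgebra
    have : IsScalarTower k Γ(X, ω.U i) Γ(X, ω.U i ⊓ ω.U j) :=
      IsScalarTower.of_algebraMap_eq fun c => (sres_toSections sX _ c).symm
    have : IsScalarTower k Γ(X, ω.U j) Γ(X, ω.U i ⊓ ω.U j) :=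
      IsScalarTower.of_algebraMap_eq fun c => (sres_toSections sX _ c).symm
    have : IsScalarTower Γ(X, ω.U i) Γ(X, ω.U i ⊓ ω.U j) X.functionField :=
      IsScalarTower.of_algebraMap_eq fun c => (toFunctionField_sres inf_le_left hij c).symm
    have : IsScalarTower Γ(X, ω.U j) Γ(X, ω.U i ⊓ ω.U j) X.functionField :=
      IsScalarTower.of_algebraMap_eq fun c => (toFunctionField_sres inf_le_right hij c).symm
    obtain ⟨T, hT, hdet⟩ := he i j
    refine ⟨T.map (algebraMap Γ(X, ω.U i ⊓ ω.U j) X.functionField), fun a => ?_, ?_⟩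
    · rw [he' j h2, ← KaehlerDifferential.map_map (C := Γ(X, ω.U i ⊓ ω.U j))]
      refine (congrArg (KaehlerDifferential.map k k Γ(X, ω.U i ⊓ ω.U j) X.functionField)
        (hT a)).trans ?_
      rw [map_sum]
      refine Finset.sum_congr rfl fun b _ => ?_
      rw [map_smul, he' i h1]
      rw [KaehlerDifferential.map_map, Matrix.map_apply, algebraMap_smul]
    · rw [ω.transition_eq hij, hdet]
      exact (RingHom.map_det _ _).symm

lemma IsCanonicalBundle.exists_dets {g : ℕ} {ω : LineBundle X} (h : IsCanonicalBundle sX g ω)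
    [PerfectField k] [Smooth sX] (hdim : topologicalKrullDim X = (g : ℕ∞)) :
    letI := functionFieldAlgebra sX
    ∃ (ε : Module.Basis (Fin g) X.functionField Ω[X.functionField⁄k]) (c : ω.ι → X.functionField),
      (∀ i, genericPoint X ∈ ω.U i → c i ≠ 0) ∧
      (∀ i V x, IsCenter V x → x ∈ ω.U i → c i ∈ kaehlerDets k ε V (centerSections V)) ∧
      ∀ i j, genericPoint X ∈ ω.U i → genericPoint X ∈ ω.U j → c j = ω.transition i j * c i := by
  let := functionFieldAlgebra sX
  obtain ⟨e, h1, h2, h3⟩ := h.exists_differentials hdim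
  obtain ⟨i₀, hi₀⟩ := ω.exists_mem (genericPoint X)
  obtain ⟨ε, -⟩ := h1 i₀ hi₀
  refine ⟨ε, fun i => ε.det (e i), fun i hi => ?_, fun i V x hV hx => ⟨e i, h2 i V x hV hx, rfl⟩,
    fun i j hi hj => ?_⟩
  · obtain ⟨b, hb⟩ := h1 i hi
    beta_reduce
    rw [← hb]
    exact (ε.isUnit_det b).ne_zero
  · obtain ⟨T, hT, hdet⟩ := h3 i j hi hj
    beta_reduce
    rw [funext hT, ε.det_sum_smul, hdet]

end Canonical

lemma HasPoleBound.of_finite_separable {k F K ι : Type*} [Field k] [Field F] [Field K] [Algebra k F]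
    [Algebra k K] [Fintype ι] [DecidableEq ι] (E : F →+* K)
    (hE : ∀ c : k, E (algebraMap k F c) = algebraMap k K c) (hfin : E.Finite)
    (hsep : letI := E.toAlgebra
      Algebra.IsSeparable F K) (ε : Module.Basis ι F Ω[F⁄k]) (ε' : Module.Basis ι K Ω[K⁄k])
    (B : ValuationSubring F → Set F) (B' : ValuationSubring K → Set K)
    (hB : ∀ W W' : ValuationSubring F, (∀ c : k, algebraMap k F c ∈ W) → W ≤ W' → B W ⊆ B W')
    (hBE : ∀ V : ValuationSubring K, (∀ c : k, algebraMap k K c ∈ V) →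
      ∀ b ∈ B (V.comap E), E b ∈ B' V)
    {ℓ : ValuationSubring F → F} {ℓ' : ValuationSubring K → K}
    (hℓ : ∀ W W' : ValuationSubring F, (∀ c : k, algebraMap k F c ∈ W) → W ≤ W' → ℓ W' / ℓ W ∈ W')
    (hℓ0 : ∀ W, ℓ W ≠ 0) (hℓ0' : ∀ V, ℓ' V ≠ 0) {u : K} (hu : u ≠ 0) {d : ℕ}
    (huℓ : ∀ V : ValuationSubring K, (∀ c : k, algebraMap k K c ∈ V) →
      u * ℓ' V ^ d / E (ℓ (V.comap E)) ∈ V) :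
    ∃ δ, 0 < δ ∧ ∀ N a, HasPoleBound k (fun V => kaehlerDets k ε' V (B' V)) ℓ' N a →
      HasPoleBound k (fun W => kaehlerDets k ε W (B W)) ℓ (δ * N) (δ * (d * a)) := by
  algebraize [E]
  have : IsScalarTower k F K := .of_algebraMap_eq fun c => (hE c).symm
  have : FiniteDimensional F K := hfin
  obtain ⟨e', he'⟩ := exists_kaehlerBasis_of_isSeparable (K := K) ε
  refine ⟨Module.finrank F K, Module.finrank_pos, fun N a h => ?_⟩
  refine h.norm (fun W W' hW hWW' => kaehlerDets_mono ε hWW' (hB W W' hW hWW')) hℓ hℓ0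
    (ε'.isUnit_det e').ne_zero (fun V hV κ hκ => ?_) hu huℓ hℓ0'
  exact algebraMap_mul_mem_kaehlerDets ε ε' e' he' (hBE V hV) hκ

section

open LineBundle

variable {X : Scheme.{u}} [IsIntegral X] {k : Type u} [Field k] (sX : X ⟶ Spec (CommRingCat.of k))

lemma LineBundle.IsAmple.exists_hasPoleBound_pow [IsProper sX] {L : LineBundle X} (hL : L.IsAmple)
    {φ : X ⟶ X} (hφ : φ ≫ sX = sX) (hsep : IsSeparableSelfMap φ) {d : ℕ}
    (hpull : (pullbackLB φ L).EquivLB (L.pow d))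
    (ℓ : ValuationSubring X.functionField → X.functionField) (hℓ0 : ∀ V, ℓ V ≠ 0)
    (hℓ : ∀ V x, IsCenter V x → ∃ i, x ∈ L.U i ∧ ℓ V = L.gen i) {g : ℕ} :
    letI := functionFieldAlgebra sX
    ∀ ε : Module.Basis (Fin g) X.functionField Ω[X.functionField⁄k],
      ∃ N δ, 0 < δ ∧ ∀ m, HasPoleBound k (fun V => kaehlerDets k ε V (centerSections V)) ℓ
        (δ ^ m * N) ((δ * d) ^ m) := by
  intro ε
  let := functionFieldAlgebra sX
  obtain ⟨N, hN⟩ := hL.exists_hasPoleBound sX ℓ hℓ ε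
  obtain ⟨hg, hsep⟩ := hsep
  have : LocallyOfFiniteType (φ ≫ sX) := by rw [hφ]; infer_instance
  have := locallyOfFiniteType_of_comp φ sX
  obtain ⟨u, hu, huℓ⟩ := L.exists_pullback_factor sX φ hg hpull
  set E := functionFieldMap φ hg
  have hE (c : k) : E (baseToFunctionField sX c) = baseToFunctionField sX c :=
    functionFieldMap_baseToFunctionField φ hg sX hφ c
  have hcomap {V : ValuationSubring X.functionField} (hV : ∀ c : k, algebraMap k _ c ∈ V) (c : k) :
      baseToFunctionField sX c ∈ V.comap E := by
    rw [ValuationSubring.mem_comap, hE]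
    exact hV c
  obtain ⟨δ, hδ, h⟩ := HasPoleBound.of_finite_separable E hE (finite_functionFieldMap φ hg hsep)
    hsep ε ε centerSections centerSections
    (fun W W' hW hWW' => by
      obtain ⟨x, hx⟩ := exists_isCenter sX fun c => hWW' (hW c)
      exact centerSections_mono sX hx hWW')
    (fun V hV b hb => by
      obtain ⟨x, hx⟩ := exists_isCenter sX hV
      exact functionFieldMap_mem_centerSections sX φ hg hx hb)
    (fun W W' hW hWW' => by
      obtain ⟨x, hx⟩ := exists_isCenter sX hW
      obtain ⟨x', hx'⟩ := exists_isCenter sX fun c => hWW' (hW c)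
      obtain ⟨i, hi, hi'⟩ := hℓ W x hx
      obtain ⟨j, hj, hj'⟩ := hℓ W' x' hx'
      rw [hi', hj']
      exact L.gen_div_gen_mem hx' (hx.mem_of_le sX hx' hWW' hi) hj) hℓ0 hℓ0 hu
    (fun V hV => by
      obtain ⟨x, hx⟩ := exists_isCenter sX hV
      obtain ⟨y, hy⟩ := exists_isCenter sX (hcomap hV)
      obtain ⟨i, hi, hi'⟩ := hℓ V x hx
      obtain ⟨j, hj, hj'⟩ := hℓ (V.comap E) y hy
      rw [hi', hj']
      exact huℓ V x y hx hy i j hi hj)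
  refine ⟨N, δ, hδ, fun m => ?_⟩
  induction m with
  | zero => simpa using hN
  | succ m ih =>
    convert h _ _ ih using 1 <;> ring

end

section Pluricanonical

open LineBundle

variable {X : Scheme.{u}}

lemma isUnit_of_basicOpen_eq {U : X.Opens} {a : Γ(X, U)} (h : X.basicOpen a = U) : IsUnit a :=
  RingedSpace.isUnit_of_isUnit_germ _ U a fun x hx =>
    (X.mem_basicOpen a x hx).mp (h.symm ▸ hx)

variable [IsIntegral X] {k : Type u} [Field k] (sX : X ⟶ Spec (CommRingCat.of k))

/-- A family of sections whose vanishing order is bounded by a fixed multiple of `N / a` for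
arbitrarily small `N / a` consists of units. -/
lemma isUnit_of_hasPoleBound [IsProper sX] [Smooth sX] (ω L : LineBundle X)
    (ℓ : ValuationSubring X.functionField → X.functionField) (hfin : (Set.range ℓ).Finite)
    (hℓ0 : ∀ V, ℓ V ≠ 0) (hℓ : ∀ V x, IsCenter V x → ∃ i, x ∈ L.U i ∧ ℓ V = L.gen i)
    {D : ValuationSubring X.functionField → Set X.functionField} {c : ω.ι → X.functionField}
    (hc : ∀ i V x, IsCenter V x → x ∈ ω.U i → c i ∈ D V) {n : ℕ} {s : ∀ i, Γ(X, ω.U i)}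
    {σ : X.functionField} (hσ0 : σ ≠ 0)
    (hσ : ∀ i (hi : genericPoint X ∈ ω.U i), toFunctionField X _ hi (s i) * c i ^ n = σ)
    (hbound : letI := functionFieldAlgebra sX
      ∀ C, ∃ N a, C * N < a ∧ HasPoleBound k D ℓ N a) (i : ω.ι) : IsUnit (s i) := by
  let := functionFieldAlgebra sX
  by_contra hu
  obtain ⟨x, hx, hxs⟩ : ∃ x ∈ ω.U i, x ∉ X.basicOpen (s i) := by
    by_contra! H
    exact hu (isUnit_of_basicOpen_eq (le_antisymm (X.basicOpen_le _) H))
  obtain ⟨j, hj⟩ := L.exists_mem x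
  obtain ⟨U, hU, hxU, hUle⟩ := exists_isAffineOpen_mem_and_subset (x := x) (U := ω.U i ⊓ L.U j)
    ⟨hx, hj⟩
  have hUi : U ≤ ω.U i := fun y hy => (hUle hy).1
  have hUj : U ≤ L.U j := fun y hy => (hUle hy).2
  have hg := genericPoint_mem hxU
  have : Nonempty U := ⟨⟨x, hxU⟩⟩
  let := sectionsAlgebra sX U
  have : Algebra.FiniteType k Γ(X, U) := finiteType_toSections sX hU
  have := isIntegrallyClosed_sections sX hU
  have := functionField_isFractionRing_of_isAffineOpen X U hU
  have := isScalarTower_functionField sX U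
  set h := sres X hUi (s i) with hh
  have hFh : algebraMap Γ(X, U) X.functionField h = toFunctionField X _ (hUi hg) (s i) :=
    toFunctionField_sres hUi hg _
  have hF0 : toFunctionField X _ (hUi hg) (s i) ≠ 0 := fun h0 => hσ0 <| by
    rw [← hσ i (hUi hg), h0, zero_mul]
  have h0 : h ≠ 0 := fun h0 => hF0 (by rw [← hFh, h0, map_zero])
  have hunit : ¬ IsUnit h := fun hunit => hxs <| by
    have h1 := X.basicOpen_of_isUnit hunit
    have h2 : X.basicOpen h = U ⊓ X.basicOpen (s i) := X.basicOpen_res (s i) (homOfLE hUi).op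
    exact (h2 ▸ h1.symm ▸ hxU : x ∈ U ⊓ X.basicOpen (s i)).2
  obtain ⟨C, hC⟩ := exists_vanishing_bound (k := k) (K := X.functionField) h h0 hunit
    (fun V => ℓ V / L.gen j) (fun V => div_ne_zero (hℓ0 V) (L.gen_ne_zero j))
    ((hfin.image (· / L.gen j)).subset (by rintro _ ⟨V, rfl⟩; exact ⟨ℓ V, ⟨V, rfl⟩, rfl⟩))
  obtain ⟨N, a, hlt, f, hf0, hf⟩ := hbound (C * n)
  refine (hC (n * N) a (f ^ n * σ ^ a / L.gen j ^ (n * N))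
    (div_ne_zero (mul_ne_zero (pow_ne_zero _ hf0) (pow_ne_zero _ hσ0))
      (pow_ne_zero _ (L.gen_ne_zero j))) (fun V hV => ?_) fun V hV => ?_).not_gt
    (by rwa [← mul_assoc])
  · obtain ⟨y, hy⟩ := exists_isCenter sX hV
    obtain ⟨l, hl⟩ := ω.exists_mem y
    have h1 : f ^ n * σ ^ a / L.gen j ^ (n * N) / (ℓ V / L.gen j) ^ (n * N) =
        (f * c l ^ a / ℓ V ^ N) ^ n *
          toFunctionField X _ (genericPoint_mem hl) (s l) ^ a := by
      rw [← hσ l (genericPoint_mem hl)]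
      have h2 := pow_ne_zero (n * N) (L.gen_ne_zero j)
      rw [div_pow (ℓ V), div_div, mul_div_cancel₀ _ h2, div_pow, ← pow_mul, mul_comm N]
      ring
    rw [h1]
    exact mul_mem (pow_mem (hf V hV _ (hc l V y hy hl)) _) (pow_mem (hy.mem hl _) _)
  · have hV' (b : k) : algebraMap k X.functionField b ∈ V := by
      rw [IsScalarTower.algebraMap_apply k Γ(X, U)]
      exact hV _
    obtain ⟨y, hy⟩ := exists_isCenter sX hV'
    have hyU : y ∈ U := hy.mem_of_isAffineOpen sX hU hg hV
    obtain ⟨l, hl, hl'⟩ := hℓ V y hy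
    have h1 : f ^ n * σ ^ a / L.gen j ^ (n * N) / algebraMap Γ(X, U) X.functionField h ^ a =
        (f * c i ^ a / ℓ V ^ N) ^ n * (L.gen l / L.gen j) ^ (n * N) := by
      rw [hFh, ← hσ i (hUi hg), hl']
      have h2 := pow_ne_zero (n * N) (L.gen_ne_zero l)
      have h3 := pow_ne_zero a hF0
      rw [div_pow (L.gen l), div_pow (f * c i ^ a), ← pow_mul, mul_comm N, div_mul_div_cancel₀ h2,
        div_right_comm]
      congr 1
      rw [div_eq_iff h3]
      ring
    rw [h1]
    exact mul_mem (pow_mem (hf V hV' _ (hc i V y hy (hUi hyU))) _)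
      (pow_mem (L.gen_div_gen_mem hy (hUj hyU) hl) _)

omit [IsIntegral X] in
/-- A nowhere vanishing section trivializes a line bundle. -/
lemma LineBundle.equivLB_trivial {M : LineBundle X} {s : ∀ i, Γ(X, M.U i)}
    (hs : ∀ i j, sres X (inf_le_left : M.U i ⊓ M.U j ≤ M.U i) (s i)
      = (M.t i j : Γ(X, M.U i ⊓ M.U j)) * sres X inf_le_right (s j))
    (hu : ∀ i, IsUnit (s i)) : M.EquivLB (LineBundle.trivial X) := by
  refine ⟨M.ι, M.U, M.covers, id, fun _ => PUnit.unit, fun _ => le_rfl, fun _ => le_top,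
    fun i => (hu i).unit, fun i j => Units.ext ?_⟩
  have h1 : ((LineBundle.trivial X).t PUnit.unit PUnit.unit) = 1 := rfl
  rw [h1, map_one, mul_one]
  refine Eq.trans ?_ (hs i j).symm
  change sres X _ (M.t i j : Γ(X, M.U i ⊓ M.U j)) * sres X _ (s j) = _
  rw [sres_self]

end Pluricanonical

/-- Let `X` be a smooth projective variety over an algebraically closed
field, `φ : X → X` a separable morphism and `L` an ample line bundle with
`φ*(L) ≅ L^{⊗d}`, `d > 1`. If the Kodaira dimension of `X` is `≥ 0`, then the canonical
bundle `ω_X` is torsion in `Pic(X)`: some positive tensor power of it is trivial. -/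
theorem stmt_11 {k : Type u} [Field k] [IsAlgClosed k] {X : Scheme.{u}} [IsIntegral X]
    (sX : X ⟶ Spec (CommRingCat.of k)) (hX : IsProjectiveVariety sX) (hsm : IsSmooth sX)
    (φ : X ⟶ X) (hφ : φ ≫ sX = sX) (hsep : IsSeparableSelfMap φ)
    (L : LineBundle X) (hL : L.IsAmple) (d : ℕ) (hd : 1 < d)
    (hpull : (LineBundle.pullbackLB φ L).EquivLB (L.pow d))
    (g : ℕ) (hdim : topologicalKrullDim X = (g : ℕ∞))
    (ω : LineBundle X) (hω : IsCanonicalBundle sX g ω)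
    (hkod : ∃ n : ℕ, 0 < n ∧ LineBundle.secSubmodule sX (ω.pow n) ≠ ⊥) :
    ∃ m : ℕ, 0 < m ∧ (ω.pow m).EquivLB (LineBundle.trivial X) := by
  have := IsProjectiveVariety.isProper hX
  have : Smooth sX := hsm
  have : CompactSpace X := hL.1
  let := functionFieldAlgebra sX
  obtain ⟨n, hn, hne⟩ := hkod
  refine ⟨n, hn, ?_⟩
  obtain ⟨s, hs, i₀, hi₀⟩ : ∃ s : ∀ i, Γ(X, ω.U i),
      (∀ i j, sres X (inf_le_left : ω.U i ⊓ ω.U j ≤ ω.U i) (s i)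
        = ((ω.t i j ^ n : (Γ(X, ω.U i ⊓ ω.U j))ˣ) : Γ(X, ω.U i ⊓ ω.U j))
          * sres X inf_le_right (s j)) ∧ ∃ i, s i ≠ 0 := by
    let : ∀ i, Module k Γ(X, (ω.pow n).U i) := fun _ => (LineBundle.toSections sX _).toModule
    obtain ⟨s, hs, hs0⟩ := Submodule.exists_mem_ne_zero_of_ne_bot hne
    exact ⟨s, hs, Function.ne_iff.mp hs0⟩
  refine LineBundle.equivLB_trivial (M := ω.pow n) hs ?_
  obtain ⟨ε, c, hc0, hc, hct⟩ := hω.exists_dets hdim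
  obtain ⟨ℓ, hfin, hℓ0, hℓ⟩ := L.exists_generator sX
  obtain ⟨N, δ, hδ, hbound⟩ := hL.exists_hasPoleBound_pow sX hφ hsep hpull ℓ hℓ0 hℓ ε
  have hg : genericPoint X ∈ ω.U i₀ := by
    obtain ⟨x, hx⟩ : ((ω.U i₀ : X.Opens) : Set X).Nonempty := by
      by_contra! H
      have h1 : ω.U i₀ = ⊥ := TopologicalSpace.Opens.ext H
      have : Subsingleton Γ(X, ω.U i₀) := by
        rw [h1]; infer_instance
      exact hi₀ (Subsingleton.elim _ _)
    exact genericPoint_mem hx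
  refine isUnit_of_hasPoleBound sX ω L ℓ hfin hℓ0 hℓ hc (n := n)
    (σ := toFunctionField X _ hg (s i₀) * c i₀ ^ n) ?_ (fun i hi => ?_) fun C => ?_
  · exact mul_ne_zero ((map_ne_zero_iff _ (toFunctionField_injective _ hg)).mpr hi₀)
      (pow_ne_zero _ (hc0 _ hg))
  · have hgi : genericPoint X ∈ ω.U i ⊓ ω.U i₀ := ⟨hi, hg⟩
    have h := congrArg (toFunctionField X _ hgi) (hs i i₀)
    rw [map_mul, toFunctionField_sres, toFunctionField_sres, Units.val_pow_eq_pow_val, map_pow,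
      ← ω.transition_eq] at h
    rw [h, hct i i₀ hi hg]
    ring
  · obtain ⟨m, hm⟩ := pow_unbounded_of_one_lt (C * N) hd
    refine ⟨_, _, ?_, hbound m⟩
    rw [mul_pow, mul_left_comm]
    exact Nat.mul_lt_mul_of_pos_left hm (pow_pos hδ m)
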